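/- arXiv:1610.02727 — 5 statements merged into one kernel-verified Lean document; each statement's English description precedes it below -/
import Mathlib

section
/- Let (X,T) and (Y,S) be topological dynamical systems (compact metric spaces with homeomorphisms). Let X' ⊆ X be a Borel, dense, T-invariant subset with μ(X ∖ X') = 0 for every T-invariant Borel probability measure μ on X, and let φ : X' → Y be continuous (in the subspace topology) with φ ∘ T = S ∘ φ on X'. Set Y' = φ(X') and let Z be the closure of Y' in Y. Then (1) S(Z) = Z, and (2) for every S-invariant Borel probability measure ν on Y with ν(Z) = 1, there exists a Borel set B ⊆ Y' with ν(B) = 1 (i.e., Y' is a set of full invariant measure in Z). -/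
open MeasureTheory

/-- `μ` is an invariant Borel probability measure for `f`. -/
def InvProb {Z : Type*} [MeasurableSpace Z] (f : Z → Z) (μ : Measure Z) : Prop :=
  IsProbabilityMeasure μ ∧ ∀ A : Set Z, MeasurableSet A → μ (f ⁻¹' A) = μ A

open Filter Topology Set in
/-- Over a compact space, every probability measure concentrated on the image of a continuous map
is the pushforward of a probability measure on the source. -/
theorem exists_probabilityMeasure_map_eq {E Y : Type*}
    [MetricSpace E] [CompactSpace E] [MeasurableSpace E] [BorelSpace E]
    [MetricSpace Y] [CompactSpace Y] [MeasurableSpace Y] [BorelSpace Y]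
    {p : E → Y} (hp : Continuous p) (ν : ProbabilityMeasure Y)
    (hν : ∀ᵐ y ∂(ν : Measure Y), y ∈ range p) :
    ∃ l : ProbabilityMeasure E, (l : Measure E).map p = ν := by
  obtain ⟨y₀, hy₀⟩ := hν.exists
  let s (n : ℕ) : SimpleFunc Y Y := SimpleFunc.approxOn id measurable_id (range p) y₀ hy₀ n
  have hs : ∀ᵐ y ∂(ν : Measure Y), Tendsto (fun n => s n y) atTop (𝓝 y) := by
    filter_upwards [hν] with y hy
    exact SimpleFunc.tendsto_approxOn measurable_id hy₀ (subset_closure hy)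
  have hmem (n : ℕ) (y : Y) : s n y ∈ range p :=
    SimpleFunc.approxOn_mem measurable_id hy₀ n y
  have : Nonempty E := hy₀.nonempty
  let g : Y → E := Function.invFun p
  let t (n : ℕ) : SimpleFunc Y E := (s n).map g
  have ht (n : ℕ) (y : Y) : p (t n y) = s n y := by
    simpa [t, g] using Function.invFun_eq (hmem n y)
  let lam (n : ℕ) : ProbabilityMeasure E := ν.map (t n).measurable.aemeasurable
  let U : Ultrafilter ℕ := hyperfilter ℕ
  obtain ⟨l, -, hl⟩ := isCompact_univ.ultrafilter_le_nhds (U.map lam) (by simp)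
  have hl : Tendsto lam U (𝓝 l) := hl
  refine ⟨l, ?_⟩
  have : IsProbabilityMeasure ((l : Measure E).map p) :=
    Measure.isProbabilityMeasure_map hp.aemeasurable
  refine ext_of_forall_integral_eq_of_IsFiniteMeasure fun f => ?_
  rw [integral_map hp.aemeasurable f.continuous.aestronglyMeasurable]
  have h1 := (ProbabilityMeasure.tendsto_iff_forall_integral_tendsto.1 hl)
    (f.compContinuous ⟨p, hp⟩)
  have h2 : Tendsto (fun n => ∫ y, f (s n y) ∂(ν : Measure Y)) atTop
      (𝓝 (∫ y, f y ∂(ν : Measure Y))) := by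
    refine tendsto_integral_of_dominated_convergence (fun _ => ‖f‖)
      (fun n => (f.continuous.measurable.comp (s n).measurable).aestronglyMeasurable)
      (integrable_const _) (fun n => ae_of_all _ fun y => f.norm_coe_le_norm _) ?_
    filter_upwards [hs] with y hy
    exact (f.continuous.tendsto y).comp hy
  refine tendsto_nhds_unique h1 ((h2.mono_left Nat.hyperfilter_le_atTop).congr fun n => ?_)
  simp only [lam, ProbabilityMeasure.toMeasure_map]
  rw [integral_map (t n).measurable.aemeasurable
    (BoundedContinuousFunction.continuous _).aestronglyMeasurable]
  simp [ht]

/-- The average of the pushforwards of `m` under the first `n + 1` iterates of `R`. -/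
noncomputable def orbitAverage {E : Type*} [MeasurableSpace E] (R : E → E) (m : Measure E)
    (n : ℕ) : Measure E :=
  ((n + 1 : ℕ) : ENNReal)⁻¹ • ∑ k ∈ Finset.range (n + 1), m.map R^[k]

theorem orbitAverage_isProbabilityMeasure {E : Type*} [MeasurableSpace E] {R : E → E}
    (hR : Measurable R) (m : Measure E) [IsProbabilityMeasure m] (n : ℕ) :
    IsProbabilityMeasure (orbitAverage R m n) := by
  constructor
  have h (k : ℕ) : m.map R^[k] Set.univ = 1 := by
    rw [Measure.map_apply (hR.iterate k) .univ]
    simp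
  simp only [orbitAverage, Measure.smul_apply, Measure.finsetSum_apply, h, smul_eq_mul,
    Finset.sum_const, Finset.card_range, nsmul_eq_mul, mul_one]
  exact ENNReal.inv_mul_cancel (by simp) (by simp)

theorem integral_orbitAverage {E : Type*} [TopologicalSpace E] [MeasurableSpace E] [BorelSpace E]
    {R : E → E} (hR : Measurable R) (m : Measure E) [IsProbabilityMeasure m] (n : ℕ)
    (f : BoundedContinuousFunction E ℝ) :
    ∫ x, f x ∂(orbitAverage R m n) =
      ((n : ℝ) + 1)⁻¹ * ∑ k ∈ Finset.range (n + 1), ∫ x, f (R^[k] x) ∂m := by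
  have hprob (k : ℕ) : IsProbabilityMeasure (m.map R^[k]) :=
    Measure.isProbabilityMeasure_map (hR.iterate k).aemeasurable
  rw [orbitAverage, integral_smul_measure, integral_finsetSum_measure]
  · simp only [ENNReal.toReal_inv, ENNReal.toReal_natCast, smul_eq_mul]
    push_cast
    congr 1
    refine Finset.sum_congr rfl fun k _ => ?_
    rw [integral_map (hR.iterate k).aemeasurable
      f.continuous.measurable.aestronglyMeasurable]
  · exact fun k _ => f.integrable _

theorem map_orbitAverage_of_semiconj {E Y : Type*} [MeasurableSpace E] [MeasurableSpace Y]
    {R : E → E} {S : Y → Y} {p : E → Y} (hR : Measurable R) (hS : Measurable S)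
    (hp : Measurable p) (h : Function.Semiconj p R S) {m : Measure E}
    (hm : (m.map p).map S = m.map p) (n : ℕ) :
    (orbitAverage R m n).map p = m.map p := by
  have hk (k : ℕ) : (m.map R^[k]).map p = m.map p := by
    rw [Measure.map_map hp (hR.iterate k), (h.iterate_right k).comp_eq,
      ← Measure.map_map (hS.iterate k) hp]
    exact ((MeasurePreserving.mk hS hm).iterate k).map_eq
  rw [orbitAverage, Measure.map_smul, ← Measure.mapₗ_apply_of_measurable hp, map_sum]
  simp only [Measure.mapₗ_apply_of_measurable hp, hk, Finset.sum_const, Finset.card_range]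
  rw [← Nat.cast_smul_eq_nsmul ENNReal, smul_smul,
    ENNReal.inv_mul_cancel (by simp) (by simp), one_smul]

open Filter Topology Set in
/-- An invariant measure on a topological factor lifts to an invariant measure on the extension. -/
theorem exists_invariant_probabilityMeasure_map_eq {E Y : Type*}
    [MetricSpace E] [CompactSpace E] [MeasurableSpace E] [BorelSpace E]
    [MetricSpace Y] [CompactSpace Y] [MeasurableSpace Y] [BorelSpace Y]
    {R : E → E} {S : Y → Y} {p : E → Y} (hR : Continuous R) (hS : Continuous S)
    (hp : Continuous p) (h : Function.Semiconj p R S) (ν : ProbabilityMeasure Y)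
    (hν : ∀ᵐ y ∂(ν : Measure Y), y ∈ range p) (hinv : (ν : Measure Y).map S = ν) :
    ∃ l : ProbabilityMeasure E, (l : Measure E).map R = l ∧ (l : Measure E).map p = ν := by
  obtain ⟨m, hm⟩ := exists_probabilityMeasure_map_eq hp ν hν
  let A (n : ℕ) : ProbabilityMeasure E :=
    ⟨orbitAverage R m n, orbitAverage_isProbabilityMeasure hR.measurable m n⟩
  let U : Ultrafilter ℕ := hyperfilter ℕ
  obtain ⟨l, -, hl⟩ := isCompact_univ.ultrafilter_le_nhds (U.map A) (by simp)
  have hl : Tendsto A U (𝓝 l) := hl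
  have hint := ProbabilityMeasure.tendsto_iff_forall_integral_tendsto.1 hl
  refine ⟨l, ?_, ?_⟩
  · have : IsProbabilityMeasure ((l : Measure E).map R) :=
      Measure.isProbabilityMeasure_map hR.aemeasurable
    refine ext_of_forall_integral_eq_of_IsFiniteMeasure fun f => ?_
    rw [integral_map hR.aemeasurable f.continuous.aestronglyMeasurable]
    have h1 := (hint (f.compContinuous ⟨R, hR⟩)).sub (hint f)
    refine sub_eq_zero.1 (tendsto_nhds_unique h1 ?_)
    refine Tendsto.mono_left ?_ Nat.hyperfilter_le_atTop
    have h3 : Tendsto (fun n : ℕ => ((n : ℝ) + 1)⁻¹ * (2 * ‖f‖)) atTop (𝓝 0) := by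
      simpa [one_div] using (tendsto_one_div_add_atTop_nhds_zero_nat (𝕜 := ℝ)).mul_const (2 * ‖f‖)
    refine squeeze_zero_norm (fun n => ?_) h3
    simp only [A, ProbabilityMeasure.coe_mk, integral_orbitAverage hR.measurable]
    rw [← mul_sub, norm_mul, ← Finset.sum_sub_distrib]
    simp only [BoundedContinuousFunction.compContinuous_apply, ContinuousMap.coe_mk,
      ← Function.iterate_succ_apply' R]
    rw [Finset.sum_range_sub (fun k => ∫ x, f (R^[k] x) ∂(m : Measure E))]
    have hb (k : ℕ) : ‖∫ x, f (R^[k] x) ∂(m : Measure E)‖ ≤ ‖f‖ := by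
      simpa using norm_integral_le_of_norm_le_const (μ := (m : Measure E))
        (ae_of_all _ fun x => f.norm_coe_le_norm (R^[k] x))
    have hn : ‖((n : ℝ) + 1)⁻¹‖ = ((n : ℝ) + 1)⁻¹ := Real.norm_of_nonneg (by positivity)
    rw [hn]
    gcongr
    exact (norm_sub_le _ _).trans (by linarith [hb (n + 1), hb 0])
  · have hmap := ProbabilityMeasure.tendsto_map_of_tendsto_of_continuous A l hl hp
    have hA (n : ℕ) : (A n).map hp.aemeasurable = ν := by
      apply ProbabilityMeasure.toMeasure_injective
      rw [ProbabilityMeasure.toMeasure_map, ← hm]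
      exact map_orbitAverage_of_semiconj hR.measurable hS.measurable hp.measurable h
        (by rw [hm, hinv]) n
    simp only [hA] at hmap
    have := tendsto_nhds_unique hmap tendsto_const_nhds
    rw [← ProbabilityMeasure.toMeasure_map l hp.aemeasurable, this]

/-- Over a point of continuity, the closure of a graph contains only the graph. -/
theorem eq_of_mem_closure_graphOn {X Y : Type*} [TopologicalSpace X] [TopologicalSpace Y]
    [T2Space Y] {s : Set X} {f : X → Y} {w : X × Y} (hw : w ∈ closure (s.graphOn f))
    (hf : ContinuousWithinAt f s w.1) : w.2 = f w.1 := by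
  have := mem_closure_iff_nhdsWithin_neBot.1 hw
  have hfst : Filter.Tendsto Prod.fst (nhdsWithin w (s.graphOn f)) (nhdsWithin w.1 s) := by
    refine tendsto_nhdsWithin_iff.2 ⟨continuous_fst.continuousAt.mono_left nhdsWithin_le_nhds, ?_⟩
    filter_upwards [self_mem_nhdsWithin]
    rintro _ ⟨x, hx, rfl⟩
    exact hx
  have h1 : Filter.Tendsto (fun z : X × Y => f z.1) (nhdsWithin w (s.graphOn f))
      (nhds (f w.1)) := hf.tendsto.comp hfst
  have h2 : Filter.Tendsto Prod.snd (nhdsWithin w (s.graphOn f)) (nhds w.2) :=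
    continuous_snd.continuousAt.mono_left nhdsWithin_le_nhds
  refine tendsto_nhds_unique h2 (h1.congr' ?_)
  filter_upwards [self_mem_nhdsWithin]
  rintro _ ⟨x, hx, rfl⟩
  rfl

theorem stmt_12 {X Y : Type*}
    [MetricSpace X] [CompactSpace X] [Nonempty X] [MeasurableSpace X] [BorelSpace X]
    [MetricSpace Y] [CompactSpace Y] [Nonempty Y] [MeasurableSpace Y] [BorelSpace Y]
    (T : X ≃ₜ X) (S : Y ≃ₜ Y)
    (X' : Set X) (hXm : MeasurableSet X') (hXd : Dense X') (hXinv : T '' X' = X')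
    (hXfull : ∀ μ : Measure X, InvProb T μ → μ X'ᶜ = 0)
    (φ : X → Y) (hφc : ContinuousOn φ X')
    (hφe : ∀ x ∈ X', φ (T x) = S (φ x)) :
    S '' closure (φ '' X') = closure (φ '' X') ∧
    ∀ ν : Measure Y, InvProb S ν → ν (closure (φ '' X')) = 1 →
      ∃ B : Set Y, B ⊆ φ '' X' ∧ MeasurableSet B ∧ ν B = 1 := by
  refine ⟨?_, fun ν ⟨hνp, hνi⟩ hν1 => ?_⟩
  · rw [S.image_closure, Set.image_image, Set.image_congr fun x hx => (hφe x hx).symm,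
      ← Set.image_image φ T, hXinv]
  let W : Set (X × Y) := closure (X'.graphOn φ)
  have hWR : Set.MapsTo (Prod.map T S) W W := by
    refine Set.MapsTo.closure ?_ (T.continuous.prodMap S.continuous)
    rintro _ ⟨x, hx, rfl⟩
    exact ⟨T x, hXinv ▸ Set.mem_image_of_mem T hx, by simp [hφe x hx]⟩
  have : CompactSpace W := isCompact_iff_compactSpace.1 isClosed_closure.isCompact
  let p : W → Y := fun w => w.1.2
  let q : W → X := fun w => w.1.1
  have hp : Continuous p := continuous_snd.comp continuous_subtype_val
  have hq : Continuous q := continuous_fst.comp continuous_subtype_val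
  let R : W → W := hWR.restrict
  have hR : Continuous R := (T.continuous.prodMap S.continuous).restrict hWR
  have hrange : closure (φ '' X') ⊆ Set.range p := by
    refine closure_minimal ?_ (isCompact_range hp).isClosed
    rintro _ ⟨x, hx, rfl⟩
    exact ⟨⟨(x, φ x), subset_closure ⟨x, hx, rfl⟩⟩, rfl⟩
  have hae : ∀ᵐ y ∂ν, y ∈ Set.range p := by
    have : ∀ᵐ y ∂ν, y ∈ closure (φ '' X') :=
      (mem_ae_iff_prob_eq_one isClosed_closure.measurableSet).2 hν1
    exact this.mono fun y hy => hrange hy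
  have hνS : ν.map S = ν := by
    ext A hA
    rw [Measure.map_apply S.continuous.measurable hA, hνi A hA]
  obtain ⟨l, hlR, hlp⟩ := exists_invariant_probabilityMeasure_map_eq hR S.continuous hp
    (fun _ => rfl) ⟨ν, hνp⟩ hae hνS
  have hlp : (l : Measure W).map p = ν := hlp
  let μ : Measure X := (l : Measure W).map q
  have hμp : IsProbabilityMeasure μ := Measure.isProbabilityMeasure_map hq.aemeasurable
  have hμT : μ.map T = μ := by
    have : T ∘ q = q ∘ R := rfl
    rw [Measure.map_map T.continuous.measurable hq.measurable, this,
      ← Measure.map_map hq.measurable hR.measurable, hlR]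
  have hμ0 : μ X'ᶜ = 0 := hXfull μ ⟨hμp, fun A hA => by
    rw [← Measure.map_apply T.continuous.measurable hA, hμT]⟩
  have hμ1 : μ X' = 1 := (prob_compl_eq_zero_iff hXm).1 hμ0
  choose K hKX hKc hK using fun n : ℕ =>
    hXm.exists_isCompact_lt_add (μ := μ) (measure_ne_top _ _)
      (ENNReal.inv_ne_zero.2 (ENNReal.natCast_ne_top n))
  refine ⟨⋃ n, φ '' K n, Set.iUnion_subset fun n => Set.image_mono (hKX n),
    .iUnion fun n => ((hKc n).image_of_continuousOn (hφc.mono (hKX n))).measurableSet, ?_⟩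
  have hB : MeasurableSet (⋃ n, φ '' K n) :=
    .iUnion fun n => ((hKc n).image_of_continuousOn (hφc.mono (hKX n))).measurableSet
  have hle (n : ℕ) : μ (K n) ≤ ν (⋃ n, φ '' K n) := by
    rw [← hlp, Measure.map_apply hp.measurable hB,
      Measure.map_apply hq.measurable (hKc n).measurableSet]
    refine measure_mono fun w hw => Set.mem_iUnion.2 ⟨n, w.1.1, hw, ?_⟩
    exact (eq_of_mem_closure_graphOn w.2 (hφc _ (hKX n hw))).symm
  refine le_antisymm prob_le_one ?_
  have hlim : Filter.Tendsto (fun n : ℕ => ν (⋃ n, φ '' K n) + (n : ENNReal)⁻¹) Filter.atTop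
      (nhds (ν (⋃ n, φ '' K n))) := by
    simpa using ENNReal.tendsto_inv_nat_nhds_zero.const_add (ν (⋃ n, φ '' K n))
  refine ge_of_tendsto' hlim fun n => ?_
  rw [← hμ1]
  exact (hK n).le.trans (by gcongr; exact hle n)
end

section
/- Let (Y,S) and (X,T) be topological dynamical systems (compact metric spaces with homeomorphisms). Let Y' ⊆ Y be a Borel, dense, S-invariant subset with ν(Y ∖ Y') = 0 for every S-invariant Borel probability measure ν on Y, and let φ : Y' → X be continuous (in the subspace topology), injective, with φ ∘ S = T ∘ φ on Y' and with φ(Y') dense in X (i.e., φ is a finitary isomorphism). For each S-invariant Borel probability measure ν on Y let Φ(ν) be the pushforward under φ of the restriction of ν to Y'. Then Φ is an affine bijection from the set of S-invariant Borel probability measures on Y onto the set of T-invariant Borel probability measures on X, Φ is a homeomorphism with respect to the weak-* topologies, and for every such ν the map φ is a measure-theoretic isomorphism between (Y,ν,S) and (X,Φ(ν),T). -/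
open MeasureTheory

/-- The pushforward under `φ` of the restriction of a measure to `Y'`. -/
noncomputable def pushF {Y X : Type*} [MeasurableSpace Y] [MeasurableSpace X]
    (φ : Y → X) (Y' : Set Y) (ν : Measure Y) : Measure X :=
  Measure.map φ (ν.restrict Y')

open Filter Topology BoundedContinuousFunction

section Cesaro

/-- The Cesàro averages of a measure along the orbit of a map. -/
noncomputable def cesaroMeasure {Z : Type*} [MeasurableSpace Z]
    (R : Z → Z) (l : Measure Z) (n : ℕ) : Measure Z :=
  ((n : ENNReal) + 1)⁻¹ • ∑ k ∈ Finset.range (n + 1), l.map R^[k]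

lemma cesaroMeasure_apply {Z : Type*} [MeasurableSpace Z]
    {R : Z → Z} (hR : Measurable R) (l : Measure Z) (n : ℕ) {A : Set Z}
    (hA : MeasurableSet A) :
    cesaroMeasure R l n A =
      ((n : ENNReal) + 1)⁻¹ * ∑ k ∈ Finset.range (n + 1), l (R^[k] ⁻¹' A) := by
  simp only [cesaroMeasure, Measure.smul_apply, Measure.finsetSum_apply, smul_eq_mul]
  congr 1
  exact Finset.sum_congr rfl fun k _ => Measure.map_apply (hR.iterate k) hA

lemma inv_mul_sum_range_const (n : ℕ) (c : ENNReal) :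
    ((n : ENNReal) + 1)⁻¹ * ∑ _k ∈ Finset.range (n + 1), c = c := by
  rw [Finset.sum_const, Finset.card_range, nsmul_eq_mul, ← mul_assoc]
  push_cast
  rw [ENNReal.inv_mul_cancel (by simp) (by finiteness), one_mul]

lemma isProbabilityMeasure_cesaroMeasure {Z : Type*} [MeasurableSpace Z]
    {R : Z → Z} (hR : Measurable R) (l : Measure Z)
    [IsProbabilityMeasure l] (n : ℕ) : IsProbabilityMeasure (cesaroMeasure R l n) := by
  constructor
  rw [cesaroMeasure_apply hR l n MeasurableSet.univ]
  simpa using inv_mul_sum_range_const n 1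

lemma integral_cesaroMeasure {Z : Type*} [MetricSpace Z] [MeasurableSpace Z] [BorelSpace Z]
    {R : Z → Z} (hR : Continuous R) (l : Measure Z)
    [IsProbabilityMeasure l] (n : ℕ) (f : Z →ᵇ ℝ) :
    ∫ z, f z ∂(cesaroMeasure R l n) =
      ((n : ℝ) + 1)⁻¹ * ∑ k ∈ Finset.range (n + 1), ∫ z, f (R^[k] z) ∂l := by
  have hp : ∀ k, IsProbabilityMeasure (l.map R^[k]) := fun k =>
    Measure.isProbabilityMeasure_map (hR.iterate k).aemeasurable
  rw [cesaroMeasure, integral_smul_measure, integral_finsetSum_measure]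
  · rw [smul_eq_mul]
    congr 1
    · simp [ENNReal.toReal_add]
    · exact Finset.sum_congr rfl fun k _ => integral_map (hR.iterate k).aemeasurable
        f.continuous.stronglyMeasurable.aestronglyMeasurable
  · exact fun k _ => f.integrable _

end Cesaro

section Lifting

variable {Z X : Type*}
  [MetricSpace Z] [CompactSpace Z] [MeasurableSpace Z] [BorelSpace Z]
  [MetricSpace X] [CompactSpace X] [MeasurableSpace X] [BorelSpace X]

/-- A sequence of probability measures on a compact metric space has a weak limit along some
nontrivial filter finer than `atTop`. -/
lemma exists_tendsto_hyperfilter (u : ℕ → ProbabilityMeasure Z) :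
    ∃ l, Tendsto u (hyperfilter ℕ : Filter ℕ) (𝓝 l) := by
  obtain ⟨l, -, hl⟩ := isCompact_univ.ultrafilter_le_nhds ((hyperfilter ℕ).map u) (by simp)
  exact ⟨l, hl⟩

/-- Probability measures lift along continuous surjections of compact metric spaces. -/
lemma exists_map_eq_of_surjective {q : Z → X} (hq : Continuous q) (hs : Function.Surjective q)
    (μ : ProbabilityMeasure X) :
    ∃ l : ProbabilityMeasure Z, l.map hq.aemeasurable = μ := by
  obtain ⟨x₀⟩ := μ.nonempty
  obtain ⟨σ, hσ⟩ := hs.hasRightInverse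
  let g : ℕ → SimpleFunc X X := fun n =>
    SimpleFunc.approxOn id measurable_id Set.univ x₀ (Set.mem_univ _) n
  have hg : ∀ x, Tendsto (fun n => g n x) atTop (𝓝 x) := fun x =>
    SimpleFunc.tendsto_approxOn measurable_id (Set.mem_univ _) (by simp)
  have hm : ∀ n, Measurable fun x => σ (g n x) := fun n => ((g n).map σ).measurable
  let u : ℕ → ProbabilityMeasure Z := fun n => μ.map (hm n).aemeasurable
  obtain ⟨l, hl⟩ := exists_tendsto_hyperfilter u
  refine ⟨l, ?_⟩
  have h1 := ProbabilityMeasure.tendsto_map_of_tendsto_of_continuous u l hl hq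
  refine tendsto_nhds_unique h1 ?_
  refine Tendsto.mono_left ?_ Nat.hyperfilter_le_atTop
  rw [ProbabilityMeasure.tendsto_iff_forall_integral_tendsto]
  intro f
  have h2 : ∀ n, ∫ x, f x ∂((u n).map hq.aemeasurable : Measure X) =
      ∫ x, f (g n x) ∂(μ : Measure X) := by
    intro n
    have hfm : StronglyMeasurable f := f.continuous.stronglyMeasurable
    rw [ProbabilityMeasure.toMeasure_map, ProbabilityMeasure.toMeasure_map,
      integral_map hq.aemeasurable hfm.aestronglyMeasurable,
      integral_map (f := fun z => f (q z)) (hm n).aemeasurable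
        (hfm.comp_measurable hq.measurable).aestronglyMeasurable]
    simp only [hσ (g n _)]
  simp only [h2]
  refine tendsto_integral_of_dominated_convergence (fun _ => ‖f‖) ?_ (integrable_const _) ?_ ?_
  · exact fun n => (f.continuous.measurable.comp (g n).measurable).aestronglyMeasurable
  · exact fun n => ae_of_all _ fun x => f.norm_coe_le_norm _
  · exact ae_of_all _ fun x => (f.continuous.tendsto x).comp (hg x)

/-- Invariant probability measures lift along factor maps of compact metric systems. -/
lemma exists_invariant_map_eq {R : Z → Z} (hR : Continuous R) {T : X → X} {q : Z → X}
    (hq : Continuous q) (hs : Function.Surjective q) (hqR : Function.Semiconj q R T)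
    (μ : ProbabilityMeasure X)
    (hμ : ∀ A, MeasurableSet A → (μ : Measure X) (T ⁻¹' A) = (μ : Measure X) A)
    (hT : Continuous T) :
    ∃ l : ProbabilityMeasure Z,
      (∀ A, MeasurableSet A → (l : Measure Z) (R ⁻¹' A) = (l : Measure Z) A) ∧
      l.map hq.aemeasurable = μ := by
  obtain ⟨l₀, hl₀⟩ := exists_map_eq_of_surjective hq hs μ
  have hp := isProbabilityMeasure_cesaroMeasure hR.measurable (l₀ : Measure Z)
  let u : ℕ → ProbabilityMeasure Z := fun n => ⟨cesaroMeasure R l₀ n, hp n⟩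
  obtain ⟨l, hl⟩ := exists_tendsto_hyperfilter u
  refine ⟨l, ?_, ?_⟩
  · have hRl : Measure.map R (l : Measure Z) = l := by
      have := Measure.isProbabilityMeasure_map (μ := (l : Measure Z)) hR.aemeasurable
      refine ext_of_forall_integral_eq_of_IsFiniteMeasure fun f => ?_
      rw [integral_map hR.aemeasurable f.continuous.stronglyMeasurable.aestronglyMeasurable]
      let fR : Z →ᵇ ℝ := f.compContinuous ⟨R, hR⟩
      have h1 := ProbabilityMeasure.tendsto_iff_forall_integral_tendsto.1 hl f
      have h2 := ProbabilityMeasure.tendsto_iff_forall_integral_tendsto.1 hl fR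
      have h3 := h2.sub h1
      refine sub_eq_zero.1 (tendsto_nhds_unique h3 ?_)
      refine Tendsto.mono_left ?_ Nat.hyperfilter_le_atTop
      have hb : ∀ k, |∫ z, f (R^[k] z) ∂(l₀ : Measure Z)| ≤ ‖f‖ := fun k => by
        have := norm_integral_le_of_norm_le_const (μ := (l₀ : Measure Z))
          (ae_of_all _ fun z => f.norm_coe_le_norm (R^[k] z))
        simpa using this
      refine squeeze_zero_norm (a := fun n : ℕ => (2 * ‖f‖) * (1 / ((n : ℝ) + 1))) (fun n => ?_) ?_
      · change ‖∫ z, fR z ∂(cesaroMeasure R l₀ n) - ∫ z, f z ∂(cesaroMeasure R l₀ n)‖ ≤ _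
        rw [integral_cesaroMeasure hR, integral_cesaroMeasure hR, ← mul_sub,
          ← Finset.sum_sub_distrib]
        have : ∀ k, ∫ z, fR (R^[k] z) ∂(l₀ : Measure Z) =
            ∫ z, f (R^[k + 1] z) ∂(l₀ : Measure Z) := fun k => by
          simp only [Function.iterate_succ_apply']; rfl
        simp only [this]
        rw [Finset.sum_range_sub (fun k => ∫ z, f (R^[k] z) ∂(l₀ : Measure Z)), norm_mul,
          mul_comm, one_div, norm_inv, Real.norm_of_nonneg (by positivity : (0 : ℝ) ≤ n + 1)]
        refine mul_le_mul_of_nonneg_right ?_ (by positivity)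
        rw [two_mul]
        exact (norm_sub_le _ _).trans (add_le_add (hb _) (hb _))
      · simpa using tendsto_one_div_add_atTop_nhds_zero_nat.const_mul (2 * ‖f‖)
    intro A hA
    rw [← Measure.map_apply hR.measurable hA, hRl]
  · have h1 := ProbabilityMeasure.tendsto_map_of_tendsto_of_continuous u l hl hq
    refine tendsto_nhds_unique h1 ?_
    have hu : ∀ n, (u n).map hq.aemeasurable = μ := by
      intro n
      refine ProbabilityMeasure.eq_of_forall_toMeasure_apply_eq _ _ fun A hA => ?_
      rw [ProbabilityMeasure.toMeasure_map, Measure.map_apply hq.measurable hA]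
      change cesaroMeasure R l₀ n _ = _
      rw [cesaroMeasure_apply hR.measurable _ _ (hq.measurable hA),
        ← inv_mul_sum_range_const n ((μ : Measure X) A)]
      congr 1
      refine Finset.sum_congr rfl fun k _ => ?_
      have h2 : R^[k] ⁻¹' (q ⁻¹' A) = q ⁻¹' (T^[k] ⁻¹' A) := by
        ext z
        simp [(hqR.iterate_right k).eq z]
      rw [h2, ← Measure.map_apply hq.measurable ((hT.iterate k).measurable hA),
        ← ProbabilityMeasure.toMeasure_map l₀ hq.aemeasurable, hl₀]
      exact ((⟨hT.measurable, Measure.ext fun B hB => by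
        rw [Measure.map_apply hT.measurable hB, hμ B hB]⟩ :
          MeasurePreserving T (μ : Measure X) μ).iterate k).measure_preimage hA.nullMeasurableSet
    simpa only [hu] using tendsto_const_nhds

end Lifting

section Pushforward

variable {Y X : Type*}
  [MetricSpace Y] [CompactSpace Y] [MeasurableSpace Y] [BorelSpace Y]
  [MetricSpace X] [MeasurableSpace X] [BorelSpace X]

lemma pushF_apply {Y : Type*} [MetricSpace Y] [MeasurableSpace Y] [BorelSpace Y]
    {f : Y → X} {D : Set Y} (hD : MeasurableSet D) (hf : ContinuousOn f D)
    (ν : Measure Y) {A : Set X} (hA : MeasurableSet A) :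
    pushF f D ν A = ν (f ⁻¹' A ∩ D) := by
  rw [pushF, Measure.map_apply_of_aemeasurable (hf.aemeasurable hD) hA,
    Measure.restrict_apply' hD]

lemma pushF_image {f : Y → X} {D : Set Y} (hD : MeasurableSet D) (hf : ContinuousOn f D)
    (hi : Set.InjOn f D) {ν : Measure Y} (hν : ν Dᶜ = 0) {B : Set Y} (hB : MeasurableSet B) :
    MeasurableSet (f '' (B ∩ D)) ∧ pushF f D ν (f '' (B ∩ D)) = ν B := by
  have hm : MeasurableSet (f '' (B ∩ D)) :=
    (hB.inter hD).image_of_continuousOn_injOn (hf.mono Set.inter_subset_right)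
      (hi.mono Set.inter_subset_right)
  refine ⟨hm, ?_⟩
  rw [pushF_apply hD hf ν hm, ← measure_inter_conull hν (s := B)]
  congr 1
  ext y
  constructor
  · rintro ⟨⟨z, hz, hzy⟩, hy⟩
    rwa [← hi hz.2 hy hzy]
  · exact fun hy => ⟨⟨y, hy, rfl⟩, hy.2⟩

lemma pushF_injective {f : Y → X} {D : Set Y} (hD : MeasurableSet D) (hf : ContinuousOn f D)
    (hi : Set.InjOn f D) {ν₁ ν₂ : Measure Y} (h₁ : ν₁ Dᶜ = 0) (h₂ : ν₂ Dᶜ = 0)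
    (h : pushF f D ν₁ = pushF f D ν₂) : ν₁ = ν₂ := by
  ext B hB
  rw [← (pushF_image hD hf hi h₁ hB).2, ← (pushF_image hD hf hi h₂ hB).2, h]

lemma pushF_eq_map {Y X : Type*} [MeasurableSpace Y] [MeasurableSpace X]
    {f : Y → X} {D : Set Y} {ν : Measure Y} (hν : ν Dᶜ = 0) :
    pushF f D ν = ν.map f := by
  rw [pushF, Measure.restrict_eq_self_of_ae_mem (show ∀ᵐ y ∂ν, y ∈ D from hν)]

end Pushforward

section InvariantMeasures

/-- The space of invariant Borel probability measures of a map, with the weak-* topology. -/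
abbrev InvMeasures {Z : Type*} [MeasurableSpace Z] (f : Z → Z) : Type _ :=
  {ν : ProbabilityMeasure Z //
    ∀ A : Set Z, MeasurableSet A → ν.toMeasure (f ⁻¹' A) = ν.toMeasure A}

variable {Z X : Type*}
  [MetricSpace Z] [CompactSpace Z] [MeasurableSpace Z] [BorelSpace Z]
  [MetricSpace X] [CompactSpace X] [MeasurableSpace X] [BorelSpace X]

lemma compactSpace_invMeasures {R : Z → Z} (hR : Continuous R) :
    CompactSpace (InvMeasures R) := by
  have hset : {ν : ProbabilityMeasure Z |
      ∀ A : Set Z, MeasurableSet A → ν.toMeasure (R ⁻¹' A) = ν.toMeasure A} =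
      {ν | ν.map hR.aemeasurable = ν} := by
    ext ν
    constructor
    · intro h
      refine ProbabilityMeasure.eq_of_forall_toMeasure_apply_eq _ _ fun A hA => ?_
      rw [ProbabilityMeasure.toMeasure_map, Measure.map_apply hR.measurable hA, h A hA]
    · intro h A hA
      rw [← Measure.map_apply hR.measurable hA,
        ← ProbabilityMeasure.toMeasure_map ν hR.aemeasurable, show ν.map hR.aemeasurable = ν from h]
  have hclosed : IsClosed {ν : ProbabilityMeasure Z |
      ∀ A : Set Z, MeasurableSet A → ν.toMeasure (R ⁻¹' A) = ν.toMeasure A} :=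
    hset ▸ isClosed_eq (ProbabilityMeasure.continuous_map hR) continuous_id
  exact isCompact_iff_compactSpace.1 hclosed.isCompact

/-- A factor map that is injective on a Borel set of full measure for all invariant measures
induces a homeomorphism of the spaces of invariant measures. -/
lemma exists_homeomorph_invMeasures {R : Z → Z} (hR : Continuous R) {T : X → X}
    (hT : Continuous T) {q : Z → X} (hq : Continuous q) (hs : Function.Surjective q)
    (hqR : Function.Semiconj q R T) {D : Set Z} (hD : MeasurableSet D) (hi : Set.InjOn q D)
    (hfull : ∀ l : InvMeasures R, (l : ProbabilityMeasure Z).toMeasure Dᶜ = 0) :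
    ∃ Q : InvMeasures R ≃ₜ InvMeasures T, ∀ l,
      ((Q l : ProbabilityMeasure X) : Measure X) =
        Measure.map q ((l : ProbabilityMeasure Z) : Measure Z) := by
  have := compactSpace_invMeasures hR
  let F : InvMeasures R → InvMeasures T := fun l => ⟨l.1.map hq.aemeasurable, fun A hA => by
    rw [ProbabilityMeasure.toMeasure_map, Measure.map_apply hq.measurable hA,
      Measure.map_apply hq.measurable (hT.measurable hA), ← l.2 _ (hq.measurable hA)]
    congr 1
    ext z
    simp [hqR.eq z]⟩
  have hF : Continuous F :=
    ((ProbabilityMeasure.continuous_map hq).comp continuous_subtype_val).subtype_mk _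
  have hval : ∀ l, ((F l : ProbabilityMeasure X) : Measure X) =
      Measure.map q ((l : ProbabilityMeasure Z) : Measure Z) := fun l =>
    ProbabilityMeasure.toMeasure_map _ hq.aemeasurable
  have hbij : Function.Bijective F := by
    constructor
    · intro l₁ l₂ h
      refine Subtype.ext (ProbabilityMeasure.toMeasure_injective ?_)
      refine pushF_injective hD hq.continuousOn hi (hfull l₁) (hfull l₂) ?_
      rw [pushF_eq_map (hfull l₁), pushF_eq_map (hfull l₂), ← hval, ← hval, h]
    · intro μ
      obtain ⟨l, hl, hlμ⟩ := exists_invariant_map_eq hR hq hs hqR μ.1 μ.2 hT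
      exact ⟨⟨l, hl⟩, Subtype.ext hlμ⟩
  exact ⟨Continuous.homeoOfEquivCompactToT2 (f := Equiv.ofBijective F hbij) hF, hval⟩

end InvariantMeasures

section Graph

/-- If `φ` is continuous on `D`, the closure of its graph over `D` adds no points above `D`. -/
lemma snd_eq_of_mem_closure_graphOn {Y X : Type*} [MetricSpace Y] [MetricSpace X]
    {φ : Y → X} {D : Set Y} (hφ : ContinuousOn φ D)
    {w : Y × X} (hw : w ∈ closure (D.graphOn φ)) (hD : w.1 ∈ D) : w.2 = φ w.1 := by
  obtain ⟨u, hu, hlim⟩ := mem_closure_iff_seq_limit.1 hw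
  simp only [Set.mem_graphOn] at hu
  have h1 : Tendsto (fun n => (u n).1) atTop (𝓝[D] w.1) :=
    tendsto_nhdsWithin_iff.2
      ⟨(continuous_fst.tendsto w).comp hlim, Eventually.of_forall fun n => (hu n).1⟩
  have h2 : Tendsto (fun n => (u n).2) atTop (𝓝 (φ w.1)) := by
    simpa only [Function.comp_def, (hu _).2] using (hφ w.1 hD).tendsto.comp h1
  exact tendsto_nhds_unique ((continuous_snd.tendsto w).comp hlim) h2

variable {Y X : Type*}
  [MetricSpace Y] [CompactSpace Y] [MeasurableSpace Y] [BorelSpace Y]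
  [MetricSpace X] [CompactSpace X] [MeasurableSpace X] [BorelSpace X]

/-- The push-forward under a finitary isomorphism is a homeomorphism of the spaces of invariant
measures. -/
lemma exists_homeomorph_pushF {S : Y → Y} (hS : Continuous S) {T : X → X} (hT : Continuous T)
    {D : Set Y} (hDm : MeasurableSet D) (hDd : Dense D) (hDS : Set.MapsTo S D D)
    (hfull : ∀ ν : InvMeasures S, (ν : ProbabilityMeasure Y).toMeasure Dᶜ = 0)
    {φ : Y → X} (hφc : ContinuousOn φ D) (hφi : Set.InjOn φ D)
    (hφe : ∀ y ∈ D, φ (S y) = T (φ y)) (hφd : Dense (φ '' D)) :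
    ∃ Φ : InvMeasures S ≃ₜ InvMeasures T, ∀ ν,
      ((Φ ν : ProbabilityMeasure X) : Measure X) =
        pushF φ D ((ν : ProbabilityMeasure Y) : Measure Y) := by
  let Γ : Set (Y × X) := closure (D.graphOn φ)
  have hΓ : IsCompact Γ := isClosed_closure.isCompact
  have : CompactSpace Γ := isCompact_iff_compactSpace.1 hΓ
  have hmaps : Set.MapsTo (Prod.map S T) Γ Γ := by
    refine Set.MapsTo.closure ?_ (hS.prodMap hT)
    rintro ⟨y, x⟩ hw
    simp only [Set.mem_graphOn, Prod.map_apply] at hw ⊢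
    exact ⟨hDS hw.1, by rw [hφe y hw.1, hw.2]⟩
  let R : Γ → Γ := hmaps.restrict
  have hR : Continuous R := (hS.prodMap hT).restrict hmaps
  let p : Γ → Y := fun w => w.1.1
  let q : Γ → X := fun w => w.1.2
  have hp : Continuous p := continuous_fst.comp continuous_subtype_val
  have hq : Continuous q := continuous_snd.comp continuous_subtype_val
  have hps : Function.Surjective p := by
    have hd : DenseRange p := hDd.mono fun y hy =>
      ⟨⟨(y, φ y), subset_closure (by simpa using hy)⟩, rfl⟩
    exact Set.range_eq_univ.1 ((isCompact_range hp).isClosed.closure_eq ▸ hd.closure_range)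
  have hqs : Function.Surjective q := by
    have hd : DenseRange q := hφd.mono <| by
      rintro _ ⟨y, hy, rfl⟩
      exact ⟨⟨(y, φ y), subset_closure (by simpa using hy)⟩, rfl⟩
    exact Set.range_eq_univ.1 ((isCompact_range hq).isClosed.closure_eq ▸ hd.closure_range)
  have hpR : Function.Semiconj p R S := fun _ => rfl
  have hqR : Function.Semiconj q R T := fun _ => rfl
  have hqp : ∀ w ∈ p ⁻¹' D, q w = φ (p w) := fun w hw =>
    snd_eq_of_mem_closure_graphOn hφc w.2 hw
  have hE : MeasurableSet (p ⁻¹' D) := hp.measurable hDm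
  have hpi : Set.InjOn p (p ⁻¹' D) := fun w hw v hv h =>
    Subtype.ext (Prod.ext h (by
      change q w = q v
      rw [hqp w hw, hqp v hv, h]))
  have hqi : Set.InjOn q (p ⁻¹' D) := fun w hw v hv h =>
    hpi hw hv (hφi hw hv (by rw [← hqp w hw, ← hqp v hv, h]))
  have hEfull : ∀ l : InvMeasures R,
      (l : ProbabilityMeasure Γ).toMeasure (p ⁻¹' D)ᶜ = 0 := by
    intro l
    have h := hfull ⟨l.1.map hp.aemeasurable, fun A hA => by
      rw [ProbabilityMeasure.toMeasure_map, Measure.map_apply hp.measurable hA,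
        Measure.map_apply hp.measurable (hS.measurable hA), ← l.2 _ (hp.measurable hA)]
      rfl⟩
    rwa [ProbabilityMeasure.toMeasure_map, Measure.map_apply hp.measurable hDm.compl] at h
  obtain ⟨P, hP⟩ := exists_homeomorph_invMeasures hR hS hp hps hpR hE hpi hEfull
  obtain ⟨Q, hQ⟩ := exists_homeomorph_invMeasures hR hT hq hqs hqR hE hqi hEfull
  refine ⟨P.symm.trans Q, fun ν => ?_⟩
  obtain ⟨l, rfl⟩ := P.surjective ν
  rw [Homeomorph.trans_apply, Homeomorph.symm_apply_apply, hQ, hP]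
  have hD : ((P l : ProbabilityMeasure Y) : Measure Y).restrict D = (P l : ProbabilityMeasure Y) :=
    Measure.restrict_eq_self_of_ae_mem (hfull (P l))
  have hφm := hφc.aemeasurable (μ := ((P l : ProbabilityMeasure Y) : Measure Y)) hDm
  rw [hD, hP] at hφm
  rw [pushF_eq_map (hP l ▸ hfull (P l)), AEMeasurable.map_map_of_aemeasurable hφm hp.aemeasurable]
  exact Measure.map_congr ((show ∀ᵐ w ∂(l : ProbabilityMeasure Γ).toMeasure, w ∈ p ⁻¹' D from
    hEfull l).mono hqp)

end Graph

theorem stmt_13 {Y X : Type*}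
    [MetricSpace Y] [CompactSpace Y] [Nonempty Y] [MeasurableSpace Y] [BorelSpace Y]
    [MetricSpace X] [CompactSpace X] [Nonempty X] [MeasurableSpace X] [BorelSpace X]
    (S : Y ≃ₜ Y) (T : X ≃ₜ X)
    (Y' : Set Y) (hYm : MeasurableSet Y') (hYd : Dense Y') (hYinv : S '' Y' = Y')
    (hYfull : ∀ ν : Measure Y, InvProb S ν → ν Y'ᶜ = 0)
    (φ : Y → X) (hφc : ContinuousOn φ Y') (hφi : Set.InjOn φ Y')
    (hφe : ∀ y ∈ Y', φ (S y) = T (φ y)) (hφd : Dense (φ '' Y')) :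
    -- `pushF φ Y'` is a bijection between the sets of invariant probability measures
    Set.BijOn (pushF φ Y') {ν : Measure Y | InvProb S ν} {μ : Measure X | InvProb T μ} ∧
    -- it is affine
    (∀ ν₁ ∈ {ν : Measure Y | InvProb S ν}, ∀ ν₂ ∈ {ν : Measure Y | InvProb S ν},
      ∀ t : ENNReal, t ≤ 1 →
        pushF φ Y' (t • ν₁ + (1 - t) • ν₂) = t • pushF φ Y' ν₁ + (1 - t) • pushF φ Y' ν₂) ∧
    -- it is a homeomorphism with respect to the weak-* topologies
    (∃ Φ : {ν : ProbabilityMeasure Y //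
              ∀ A : Set Y, MeasurableSet A → ν.toMeasure (S ⁻¹' A) = ν.toMeasure A} ≃ₜ
           {μ : ProbabilityMeasure X //
              ∀ A : Set X, MeasurableSet A → μ.toMeasure (T ⁻¹' A) = μ.toMeasure A},
      ∀ ν, ((Φ ν : ProbabilityMeasure X) : Measure X) =
        pushF φ Y' ((ν : ProbabilityMeasure Y) : Measure Y)) ∧
    -- for each invariant `ν`, the map `φ` is a measure-theoretic isomorphism
    -- between `(Y, ν, S)` and `(X, pushF φ Y' ν, T)`
    (∀ ν : Measure Y, InvProb S ν →
      ∃ B : Set Y, MeasurableSet B ∧ B ⊆ Y' ∧ ν B = 1 ∧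
        Set.InjOn φ B ∧ (∀ y ∈ B, φ (S y) = T (φ y)) ∧
        MeasurableEmbedding (B.restrict φ) ∧
        MeasurableSet (φ '' B) ∧ pushF φ Y' ν (φ '' B) = 1 ∧
        ∀ A : Set X, MeasurableSet A → ν (φ ⁻¹' A ∩ B) = pushF φ Y' ν A) := by
  have hSD : Set.MapsTo S Y' Y' := Set.mapsTo_iff_image_subset.2 hYinv.subset
  obtain ⟨Φ, hΦ⟩ := exists_homeomorph_pushF S.continuous T.continuous hYm hYd hSD
    (fun ν => hYfull _ ⟨inferInstance, ν.2⟩) hφc hφi hφe hφd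
  refine ⟨⟨?_, ?_, ?_⟩, ?_, ⟨Φ, hΦ⟩, ?_⟩
  · rintro ν ⟨hν, hinv⟩
    have h := hΦ ⟨⟨ν, hν⟩, hinv⟩
    change InvProb T (pushF φ Y' ν)
    exact h ▸ ⟨inferInstance, (Φ _).2⟩
  · intro ν₁ h₁ ν₂ h₂ h
    exact pushF_injective hYm hφc hφi (hYfull _ h₁) (hYfull _ h₂) h
  · rintro μ ⟨hμ, hinv⟩
    obtain ⟨ν, hν⟩ := Φ.surjective ⟨⟨μ, hμ⟩, hinv⟩
    exact ⟨_, ⟨inferInstance, ν.2⟩, by rw [← hΦ, hν]; rfl⟩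
  · intro ν₁ _ ν₂ _ t _
    ext A hA
    simp only [Measure.add_apply, Measure.smul_apply, pushF_apply hYm hφc _ hA]
  · intro ν hν
    have := hν.1
    have h1 : ν Y' = 1 := (prob_compl_eq_zero_iff hYm).1 (hYfull ν hν)
    have himg := pushF_image hYm hφc hφi (hYfull ν hν) hYm
    rw [Set.inter_self, h1] at himg
    exact ⟨Y', hYm, subset_rfl, h1, hφi, hφe, hφc.measurableEmbedding hYm hφi, himg.1, himg.2,
      fun A hA => (pushF_apply hYm hφc ν hA).symm⟩
end

section
/- (Krieger's Marker Lemma, general case.) Let (X,T) be a zero-dimensional topological dynamical system (X a nonempty compact metric space with a basis of clopen sets, T : X → X a homeomorphism). Then for every ε > 0 and every natural number n ≥ 1 there exist a clopen set F ⊆ X and a natural number N such that (1) the sets F, T^{-1}F, …, T^{-(n-1)}F are pairwise disjoint, and (2) F ∪ T^{-1}F ∪ … ∪ T^{-N}F ⊇ X ∖ (Per_{[1,n+1]})^ε, where Per_{[1,n+1]} = {x ∈ X : ∃ p, 1 ≤ p ≤ n+1, T^p x = x} and A^ε denotes the open ε-neighborhood of a set A. -/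
open TopologicalSpace

/-- A topology has a basis of clopen sets (zero-dimensionality). -/
def ZeroDim (X : Type*) [TopologicalSpace X] : Prop :=
  ∃ B : Set (Set X), (∀ s ∈ B, IsClopen s) ∧ IsTopologicalBasis B

/-- The set of periodic points of minimal period at most `m`. -/
def PerLe {X : Type*} (T : X ≃ X) (m : ℕ) : Set X :=
  {x : X | ∃ p : ℕ, 1 ≤ p ∧ p ≤ m ∧ (T ^ p) x = x}

/-- `F` is disjoint from its first `n - 1` iterated preimages under `T`. -/
def IsMarker {X : Type*} [TopologicalSpace X] (T : X ≃ₜ X) (n : ℕ) (F : Set X) : Prop :=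
  ∀ k : ℤ, 0 < k → k < n → ∀ x ∈ F, (T ^ k) x ∉ F

theorem Homeomorph.zpow_add_apply {X : Type*} [TopologicalSpace X] (T : X ≃ₜ X) (a b : ℤ) (x : X) :
    (T ^ (a + b)) x = (T ^ a) ((T ^ b) x) := by
  rw [zpow_add]
  rfl

theorem Homeomorph.toEquiv_pow_apply {X : Type*} [TopologicalSpace X] (T : X ≃ₜ X) (k : ℕ) (x : X) :
    (T.toEquiv ^ k) x = (T ^ (k : ℤ)) x := by
  induction k generalizing x with
  | zero => simp
  | succ k ih =>
    rw [pow_succ, Equiv.Perm.mul_apply, ih, Nat.cast_succ, T.zpow_add_apply, zpow_one]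
    rfl

/-- A clopen marker set can be enlarged by the part of another one that stays away from it. -/
theorem IsMarker.exists_extend {X : Type*} [TopologicalSpace X] {T : X ≃ₜ X} {n : ℕ} (hn : 1 ≤ n)
    {F V : Set X} (hF : IsClopen F) (hFm : IsMarker T n F) (hV : IsClopen V)
    (hVm : IsMarker T n V) :
    ∃ G : Set X, IsClopen G ∧ IsMarker T n G ∧ F ⊆ G ∧
      ∀ x ∈ V, ∃ i : ℤ, -n < i ∧ i < n ∧ (T ^ i) x ∈ G := by
  refine ⟨F ∪ (V \ ⋃ i ∈ Finset.Ioo (-n : ℤ) n, ⇑(T ^ i) ⁻¹' F), ?_, ?_,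
    Set.subset_union_left, ?_⟩
  · refine hF.union (hV.diff (Set.Finite.isClopen_biUnion (Finset.finite_toSet _) ?_))
    exact fun i _ => hF.preimage (T ^ i).continuous
  · rintro k hk hkn x (hx | ⟨hx, hx'⟩) (hy | ⟨hy, hy'⟩)
    · exact hFm k hk hkn x hx hy
    · refine hy' (Set.mem_biUnion (x := -k) ?_ ?_)
      · simp only [Finset.coe_Ioo, Set.mem_Ioo]; omega
      · rw [Set.mem_preimage, ← T.zpow_add_apply, neg_add_cancel, zpow_zero]
        exact hx
    · refine hx' (Set.mem_biUnion (x := k) ?_ hy)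
      simp only [Finset.coe_Ioo, Set.mem_Ioo]; omega
    · exact hVm k hk hkn x hx hy
  · intro x hx
    by_cases h : x ∈ ⋃ i ∈ Finset.Ioo (-n : ℤ) n, ⇑(T ^ i) ⁻¹' F
    · simp only [Set.mem_iUnion, Finset.mem_Ioo] at h
      obtain ⟨i, hi, hxi⟩ := h
      exact ⟨i, hi.1, hi.2, Or.inl hxi⟩
    · refine ⟨0, by omega, by omega, Or.inr ?_⟩
      rw [zpow_zero]
      exact ⟨hx, h⟩

theorem IsMarker.exists_of_finset {X ι : Type*} [TopologicalSpace X] {T : X ≃ₜ X} {n : ℕ}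
    (hn : 1 ≤ n) (s : Finset ι) (V : ι → Set X)
    (hV : ∀ i ∈ s, IsClopen (V i) ∧ IsMarker T n (V i)) :
    ∃ F : Set X, IsClopen F ∧ IsMarker T n F ∧
      ∀ a ∈ s, ∀ x ∈ V a, ∃ i : ℤ, -n < i ∧ i < n ∧ (T ^ i) x ∈ F := by
  classical
  induction s using Finset.induction_on with
  | empty => exact ⟨∅, isClopen_empty, fun _ _ _ x hx => hx.elim, by simp⟩
  | insert a s _ ih =>
    obtain ⟨F, hF, hFm, hFc⟩ := ih fun i hi => hV i (Finset.mem_insert_of_mem hi)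
    obtain ⟨hVa, hVam⟩ := hV a (Finset.mem_insert_self a s)
    obtain ⟨G, hG, hGm, hFG, hGc⟩ := hFm.exists_extend hn hF hVa hVam
    refine ⟨G, hG, hGm, fun b hb x hx => ?_⟩
    rcases Finset.mem_insert.mp hb with rfl | hb
    · exact hGc x hx
    · obtain ⟨i, h1, h2, h3⟩ := hFc b hb x hx
      exact ⟨i, h1, h2, hFG h3⟩

/-- A point with no small period has a clopen neighborhood that is a marker set. -/
theorem ZeroDim.exists_isMarker_mem {X : Type*} [TopologicalSpace X] [T2Space X]
    (hzero : ZeroDim X) {T : X ≃ₜ X} {n : ℕ} {x : X}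
    (hx : ∀ k : ℤ, 0 < k → k < n → (T ^ k) x ≠ x) :
    ∃ V : Set X, IsClopen V ∧ IsMarker T n V ∧ x ∈ V := by
  obtain ⟨B, hB, hBasis⟩ := hzero
  have key : ∀ k ∈ Finset.Ioo (0 : ℤ) n, ∀ᶠ p in nhds x ×ˢ nhds x, (T ^ k) p.1 ≠ p.2 := by
    intro k hk
    rw [Finset.mem_Ioo] at hk
    rw [← nhds_prod_eq]
    exact (isOpen_ne_fun ((T ^ k).continuous.comp continuous_fst) continuous_snd).mem_nhds
      (hx k hk.1 hk.2)
  obtain ⟨U, hU, hUk⟩ := Filter.eventually_prod_self_iff'.mp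
    ((Filter.eventually_all_finset _).mpr key)
  obtain ⟨V, hVB, hxV, hVU⟩ := hBasis.mem_nhds_iff.mp hU
  exact ⟨V, hB V hVB, fun k hk hkn y hy hky =>
    hUk y (hVU hy) _ (hVU hky) k (Finset.mem_Ioo.mpr ⟨hk, hkn⟩) rfl, hxV⟩

theorem stmt_15 {X : Type*} [MetricSpace X] [CompactSpace X] [Nonempty X] (T : X ≃ₜ X)
    (hzero : ZeroDim X) (ε : ℝ) (hε : 0 < ε) (n : ℕ) (hn : 1 ≤ n) :
    ∃ (F : Set X) (N : ℕ), IsClopen F ∧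
      (∀ i j : ℕ, i < n → j < n → i ≠ j →
        Disjoint (⇑(T.toEquiv ^ i) ⁻¹' F) (⇑(T.toEquiv ^ j) ⁻¹' F)) ∧
      (Metric.thickening ε (PerLe T.toEquiv (n + 1)))ᶜ ⊆
        ⋃ i ∈ Finset.range (N + 1), ⇑(T.toEquiv ^ i) ⁻¹' F := by
  have hmark : ∀ x ∈ (Metric.thickening ε (PerLe T.toEquiv (n + 1)))ᶜ,
      ∃ V : Set X, IsClopen V ∧ IsMarker T n V ∧ x ∈ V := by
    intro x hx
    refine hzero.exists_isMarker_mem fun k hk hkn hkx => hx ?_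
    refine Metric.self_subset_thickening hε _ ⟨k.toNat, by omega, by omega, ?_⟩
    rw [T.toEquiv_pow_apply, Int.toNat_of_nonneg hk.le, hkx]
  choose! V hV hVm hxV using hmark
  have hK : IsCompact (Metric.thickening ε (PerLe T.toEquiv (n + 1)))ᶜ :=
    Metric.isOpen_thickening.isClosed_compl.isCompact
  obtain ⟨s, hsK, hs⟩ :=
    hK.elim_nhds_subcover V fun x hx => (hV x hx).isOpen.mem_nhds (hxV x hx)
  obtain ⟨F, hF, hFm, hFc⟩ :=
    IsMarker.exists_of_finset hn s V fun x hx => ⟨hV x (hsK x hx), hVm x (hsK x hx)⟩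
  have hlt : ∀ i j : ℕ, i < j → j < n → ∀ x, (T ^ (1 - n + i : ℤ)) x ∈ F →
      (T ^ (1 - n + j : ℤ)) x ∉ F := by
    intro i j hij hj x hi
    rw [show (1 - n + j : ℤ) = (j - i) + (1 - n + i) by ring, T.zpow_add_apply]
    exact hFm _ (by omega) (by omega) _ hi
  refine ⟨⇑(T ^ (1 - n : ℤ)) ⁻¹' F, 2 * n, hF.preimage (T ^ (1 - n : ℤ)).continuous, ?_, ?_⟩
  · intro i j hi hj hij
    rw [Set.disjoint_left]
    intro x hxi hxj
    rw [Set.mem_preimage, Set.mem_preimage, T.toEquiv_pow_apply, ← T.zpow_add_apply] at hxi hxj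
    rcases lt_or_gt_of_ne hij with h | h
    · exact hlt i j h hj x hxi hxj
    · exact hlt j i h hi x hxj hxi
  · intro x hx
    obtain ⟨a, ha, hxa⟩ := Set.mem_iUnion₂.mp (hs hx)
    obtain ⟨i, h1, h2, h3⟩ := hFc a ha x hxa
    refine Set.mem_biUnion (x := (i + n - 1).toNat) ?_ ?_
    · simp only [Finset.coe_range, Set.mem_Iio]; omega
    · rw [Set.mem_preimage, Set.mem_preimage, T.toEquiv_pow_apply, ← T.zpow_add_apply,
        Int.toNat_of_nonneg (by omega), show (1 - n + (i + n - 1) : ℤ) = i by ring]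
      exact h3
end

section
/- Let X be a nonempty compact metric zero-dimensional space, let A, B ⊆ X be closed subsets, and let f : X ∖ A → X ∖ B be a bijection which is continuous with continuous inverse (a homeomorphism in the subspace topologies). Then there exists exactly one homeomorphism g : X → X with g(x) = f(x) for all x ∈ X ∖ A if and only if the following two conditions both hold: (1) f and f^{-1} are uniformly continuous on their domains (with respect to the metric of X); (2) either the interiors of A and of B are both empty, or there exist points a, b ∈ X, isolated in X, such that the interior of A equals {a} and the interior of B equals {b}. (This is the abstract form of the decisiveness criterion for ordered Bratteli diagrams, where A is the set of maximal paths, B the set of minimal paths, and f the Vershik map on the path space.) -/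
open TopologicalSpace

section Auxiliary

open Set

section CantorSpace

variable {K : Type*} [TopologicalSpace K]

lemma exists_clopens_splitting [CompactSpace K] [T2Space K] [TotallyDisconnectedSpace K]
    (hK : ∀ x : K, ¬ IsOpen ({x} : Set K)) (U C : Clopens K) (hU : (U : Set K).Nonempty) :
    ∃ D : Clopens K, ((U : Set K) ∩ D).Nonempty ∧ ((U : Set K) \ D).Nonempty ∧
      (((U : Set K) ∩ C).Nonempty → ((U : Set K) \ C).Nonempty → D = C) := by
  by_cases h : ((U : Set K) ∩ C).Nonempty ∧ ((U : Set K) \ C).Nonempty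
  · exact ⟨C, h.1, h.2, fun _ _ => rfl⟩
  obtain ⟨x, hx⟩ := hU
  have hne : ∃ y ∈ U, y ≠ x := by
    by_contra! H
    apply hK x
    have : (U : Set K) = {x} := Subset.antisymm (fun y hy => H y hy) (by simpa using hx)
    exact this ▸ U.isClopen.isOpen
  obtain ⟨y, hy, hyx⟩ := hne
  obtain ⟨D, hD, hxD, hyD⟩ := exists_isClopen_of_totally_separated hyx.symm
  exact ⟨⟨D, hD⟩, ⟨x, hx, hxD⟩, ⟨y, hy, hyD⟩, fun h₁ h₂ => absurd ⟨h₁, h₂⟩ h⟩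

/-- The cells of the binary scheme in which the cell with address `s` is cut by the clopen set
`split s`. -/
def binaryCell (split : Clopens K → ℕ → Clopens K) : List Bool → Clopens K
  | [] => ⊤
  | b :: s =>
    if b then binaryCell split s ⊓ split (binaryCell split s) s.length
    else binaryCell split s \ split (binaryCell split s) s.length

open Classical in
/-- The address of length `n` of a point in the binary scheme. -/
noncomputable def binaryAddress (split : Clopens K → ℕ → Clopens K) (x : K) : ℕ → List Bool
  | 0 => []
  | n + 1 =>
    decide (x ∈ split (binaryCell split (binaryAddress split x n)) n) :: binaryAddress split x n

open Classical in
/-- The infinite address of a point in the binary scheme. -/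
noncomputable def binaryCode (split : Clopens K → ℕ → Clopens K) (x : K) (n : ℕ) : Bool :=
  decide (x ∈ split (binaryCell split (binaryAddress split x n)) n)

variable (split : Clopens K → ℕ → Clopens K)

lemma length_binaryAddress (x : K) (n : ℕ) : (binaryAddress split x n).length = n := by
  induction n with
  | zero => rfl
  | succ n ih => simp [binaryAddress, ih]

lemma mem_binaryCell_iff (x : K) (s : List Bool) :
    x ∈ binaryCell split s ↔ binaryAddress split x s.length = s := by
  induction s with
  | nil => exact iff_of_true (mem_univ x) rfl
  | cons b s ih =>
    rw [List.length_cons, binaryAddress, List.cons.injEq, ← ih, binaryCell]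
    cases b
    · simp only [Bool.false_eq_true, if_false, ← SetLike.mem_coe, Clopens.coe_sdiff, mem_sdiff,
        decide_eq_false_iff_not]
      constructor
      · rintro ⟨h₁, h₂⟩
        rw [ih.1 h₁]
        exact ⟨h₂, h₁⟩
      · rintro ⟨h₁, h₂⟩
        rw [ih.1 h₂] at h₁
        exact ⟨h₂, h₁⟩
    · simp only [if_true, ← SetLike.mem_coe, Clopens.coe_inf, mem_inter_iff, decide_eq_true_eq]
      constructor
      · rintro ⟨h₁, h₂⟩
        rw [ih.1 h₁]
        exact ⟨h₂, h₁⟩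
      · rintro ⟨h₁, h₂⟩
        rw [ih.1 h₂] at h₁
        exact ⟨h₂, h₁⟩

lemma mem_binaryCell_address (x : K) (n : ℕ) : x ∈ binaryCell split (binaryAddress split x n) := by
  rw [mem_binaryCell_iff, length_binaryAddress]

lemma continuous_binaryCode : Continuous (binaryCode split) := by
  refine continuous_pi fun n => IsLocallyConstant.continuous ?_
  rw [IsLocallyConstant.iff_exists_open]
  refine fun x => ⟨binaryCell split (binaryAddress split x (n + 1)),
    (binaryCell split _).isClopen.isOpen, mem_binaryCell_address split x _, fun y hy => ?_⟩
  have := (mem_binaryCell_iff split y _).1 hy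
  rw [length_binaryAddress, binaryAddress, binaryAddress, List.cons.injEq] at this
  exact this.1

lemma binaryAddress_eq_res (x : K) (n : ℕ) :
    binaryAddress split x n = PiNat.res (binaryCode split x) n := by
  induction n with
  | zero => rfl
  | succ n ih =>
    rw [PiNat.res_succ, ← ih]
    rfl

lemma surjective_binaryCode [CompactSpace K]
    (hne : ∀ s, (binaryCell split s : Set K).Nonempty) :
    Function.Surjective (binaryCode split) := by
  intro α
  have : (⋂ n, (binaryCell split (PiNat.res α n) : Set K)).Nonempty := by
    refine IsCompact.nonempty_iInter_of_sequence_nonempty_isCompact_isClosed _ (fun n => ?_)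
      (fun n => hne _) (binaryCell split _).isClopen.isClosed.isCompact
      (fun n => (binaryCell split _).isClopen.isClosed)
    rw [PiNat.res_succ, binaryCell]
    split_ifs
    · exact inter_subset_left
    · exact sdiff_subset
  obtain ⟨x, hx⟩ := this
  rw [mem_iInter] at hx
  refine ⟨x, PiNat.res_injective (funext fun n => ?_)⟩
  rw [← binaryAddress_eq_res]
  simpa using (mem_binaryCell_iff split x _).1 (hx n)

theorem nonempty_homeomorph_cantor [CompactSpace K] [T2Space K] [TotallyDisconnectedSpace K]
    [SecondCountableTopology K] [Nonempty K] (hK : ∀ x : K, ¬ IsOpen ({x} : Set K)) :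
    Nonempty (K ≃ₜ (ℕ → Bool)) := by
  have : Countable (Clopens K) := Clopens.countable_iff_secondCountable.2 inferInstance
  obtain ⟨C, hC⟩ := exists_surjective_nat (Clopens K)
  choose! D hD₁ hD₂ hD₃ using exists_clopens_splitting hK
  let split : Clopens K → ℕ → Clopens K := fun U n => D U (C n)
  have hne : ∀ s, (binaryCell split s : Set K).Nonempty := by
    intro s
    induction s with
    | nil => exact univ_nonempty
    | cons b s ih =>
      rw [binaryCell]
      split_ifs
      · exact hD₁ _ _ ih
      · exact hD₂ _ _ ih
  have hinj : Function.Injective (binaryCode split) := by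
    intro x y hxy
    by_contra hne'
    obtain ⟨V, hV, hxV, hyV⟩ := exists_isClopen_of_totally_separated hne'
    obtain ⟨n, hn⟩ := hC ⟨V, hV⟩
    have haddr : binaryAddress split x n = binaryAddress split y n := by
      rw [binaryAddress_eq_res, binaryAddress_eq_res, hxy]
    have hx := mem_binaryCell_address split x n
    have hy := mem_binaryCell_address split y n
    rw [← haddr] at hy
    have hDC : split (binaryCell split (binaryAddress split x n)) n = C n :=
      hD₃ _ _ (hne _) ⟨x, hx, by rw [hn]; exact hxV⟩ ⟨y, hy, by rw [hn]; exact hyV⟩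
    have := congrFun hxy n
    rw [binaryCode, binaryCode, ← haddr, hDC, hn, decide_eq_decide] at this
    exact hyV (this.1 hxV)
  exact ⟨(continuous_binaryCode split).homeoOfEquivCompactToT2
    (f := Equiv.ofBijective _ ⟨hinj, surjective_binaryCode split hne⟩)⟩

end CantorSpace

section Gluing

variable {X : Type*} [TopologicalSpace X]

open Classical in
/-- A space is the topological sum of a clopen subset and its complement. -/
noncomputable def IsClopen.sumComplHomeomorph {P : Set X} (hP : IsClopen P) :
    P ⊕ (Pᶜ : Set X) ≃ₜ X :=
  (Equiv.Set.sumCompl P).toHomeomorphOfContinuousOpen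
    (by
      have : ⇑(Equiv.Set.sumCompl P) = Sum.elim Subtype.val Subtype.val := by
        ext (x | x) <;> simp
      rw [this]
      exact continuous_subtype_val.sumElim continuous_subtype_val)
    (by
      have : ⇑(Equiv.Set.sumCompl P) = Sum.elim Subtype.val Subtype.val := by
        ext (x | x) <;> simp
      rw [this]
      exact hP.isOpen.isOpenMap_subtype_val.sumElim hP.compl.isOpen.isOpenMap_subtype_val)

lemma IsClopen.exists_homeomorph_extending {P Q : Set X} (hP : IsClopen P) (hQ : IsClopen Q)
    (h : P ≃ₜ Q) (k : (Pᶜ : Set X) ≃ₜ (Qᶜ : Set X)) :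
    ∃ g : X ≃ₜ X, (∀ x : P, g x = h x) ∧ ∀ x : (Pᶜ : Set X), g x = k x := by
  refine ⟨hP.sumComplHomeomorph.symm.trans ((h.sumCongr k).trans hQ.sumComplHomeomorph),
    fun x => ?_, fun x => ?_⟩
  · have : hP.sumComplHomeomorph.symm x = Sum.inl x := hP.sumComplHomeomorph.symm_apply_eq.2 rfl
    rw [Homeomorph.trans_apply, this]
    rfl
  · have : hP.sumComplHomeomorph.symm x = Sum.inr x := hP.sumComplHomeomorph.symm_apply_eq.2 rfl
    rw [Homeomorph.trans_apply, this]
    rfl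

lemma IsClopen.exists_homeomorph_ne_refl {P U : Set X} (hP : IsClopen P) (hPU : P ⊆ U)
    (h : P ≃ₜ P) {p : P} (hp : h p ≠ p) :
    ∃ σ : X ≃ₜ X, σ ≠ Homeomorph.refl X ∧ ∀ z ∉ U, σ z = z := by
  obtain ⟨σ, hσ, hσ'⟩ := hP.exists_homeomorph_extending hP h (Homeomorph.refl _)
  refine ⟨σ, fun H => hp ?_, fun z hz => hσ' ⟨z, fun hzP => hz (hPU hzP)⟩⟩
  rw [Subtype.ext_iff, ← hσ, H]
  rfl

theorem exists_homeomorph_ne_refl_of_isOpen [CompactSpace X] [T2Space X]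
    [TotallyDisconnectedSpace X] [SecondCountableTopology X] {U : Set X} (hU : IsOpen U)
    (hnt : U.Nontrivial) : ∃ σ : X ≃ₜ X, σ ≠ Homeomorph.refl X ∧ ∀ z ∉ U, σ z = z := by
  classical
  by_cases hiso : ∃ p ∈ U, ∃ q ∈ U, p ≠ q ∧ IsOpen ({p} : Set X) ∧ IsOpen ({q} : Set X)
  · obtain ⟨p, hp, q, hq, hpq, hpo, hqo⟩ := hiso
    have hopen : IsOpen ({p, q} : Set X) := by
      rw [insert_eq]
      exact hpo.union hqo
    have : DiscreteTopology ({p, q} : Set X) := by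
      infer_instance
    let e := Equiv.swap (⟨p, by simp⟩ : ({p, q} : Set X)) ⟨q, by simp⟩
    refine IsClopen.exists_homeomorph_ne_refl (P := {p, q})
      ⟨(toFinite _).isClosed, hopen⟩ (by simp [insert_subset_iff, hp, hq])
      ⟨e, continuous_of_discreteTopology, continuous_of_discreteTopology⟩ (p := ⟨p, by simp⟩) ?_
    change e _ ≠ _
    simp only [e, Equiv.swap_apply_left]
    exact fun H => hpq (congrArg Subtype.val H).symm
  · have hperf : ∃ W ⊆ U, IsOpen W ∧ W.Nonempty ∧ ∀ w ∈ W, ¬ IsOpen ({w} : Set X) := by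
      by_cases hq : ∃ q ∈ U, IsOpen ({q} : Set X)
      · obtain ⟨q, hqU, hq⟩ := hq
        obtain ⟨p, hp, hpq⟩ := hnt.exists_ne q
        exact ⟨U \ {q}, sdiff_subset, hU.sdiff isClosed_singleton, ⟨p, hp, hpq⟩,
          fun w hw hwo => hiso ⟨w, hw.1, q, hqU, hw.2, hwo, hq⟩⟩
      · push Not at hq
        exact ⟨U, Subset.rfl, hU, hnt.nonempty, hq⟩
    obtain ⟨W, hWU, hW, ⟨p, hp⟩, hWiso⟩ := hperf
    obtain ⟨V, hV, hpV, hVW⟩ := compact_exists_isClopen_in_isOpen hW hp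
    have : CompactSpace V := isCompact_iff_compactSpace.1 hV.isClosed.isCompact
    have : Nonempty V := ⟨⟨p, hpV⟩⟩
    obtain ⟨e⟩ := nonempty_homeomorph_cantor (K := V) fun x hx => hWiso x (hVW x.2) (by
      simpa using hV.isOpen.isOpenMap_subtype_val _ hx)
    have hflip : Continuous fun (α : ℕ → Bool) n => !(α n) :=
      continuous_pi fun n =>
        (continuous_of_discreteTopology (f := Bool.not)).comp (continuous_apply n)
    let F : (ℕ → Bool) ≃ₜ (ℕ → Bool) :=
      { toFun := fun α n => !(α n)
        invFun := fun α n => !(α n)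
        left_inv := fun α => by simp
        right_inv := fun α => by simp
        continuous_toFun := hflip
        continuous_invFun := hflip }
    refine hV.exists_homeomorph_ne_refl (hVW.trans hWU) ((e.trans F).trans e.symm)
      (p := ⟨p, hpV⟩) fun H => ?_
    rw [Homeomorph.trans_apply, Homeomorph.symm_apply_eq] at H
    exact Bool.not_ne_self _ (congrFun H 0)

end Gluing

section Extension

variable {X : Type*} [UniformSpace X] [CompleteSpace X] [T0Space X]

attribute [local instance] AbstractCompletion.uniformStruct

/-- In a complete space, the closure of a subset is a completion of it. -/
def closureCompletion (S : Set X) : AbstractCompletion S where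
  space := closure S
  coe := inclusion subset_closure
  uniformStruct := inferInstance
  complete := isClosed_closure.isComplete.completeSpace_coe
  separation := inferInstance
  isUniformInducing := ⟨by
    rw [uniformity_subtype, uniformity_subtype, Filter.comap_comap]
    rfl⟩
  dense := denseRange_inclusion_iff subset_closure |>.2 Subset.rfl

lemma exists_homeomorph_closure_extending {S T : Set X} (f : S ≃ₜ T) (hf : UniformContinuous f)
    (hf' : UniformContinuous f.symm) :
    ∃ h : closure S ≃ₜ closure T, ∀ x : S, (h ⟨x, subset_closure x.2⟩ : X) = f x := by
  let e : S ≃ᵤ T := ⟨f.toEquiv, hf, hf'⟩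
  refine ⟨((closureCompletion S).mapEquiv (closureCompletion T) e).toHomeomorph, fun x => ?_⟩
  exact congrArg Subtype.val ((closureCompletion S).mapEquiv_coe (closureCompletion T) e x)

end Extension

section Decisive

variable {X : Type*} [MetricSpace X] {A B : Set X} {f : ↥(Aᶜ) ≃ₜ ↥(Bᶜ)}

lemma symm_extends {g : X ≃ₜ X} (hg : ∀ (x : X) (hx : x ∈ Aᶜ), g x = ↑(f ⟨x, hx⟩)) (y : X)
    (hy : y ∈ Bᶜ) : g.symm y = ↑(f.symm ⟨y, hy⟩) := by
  rw [Homeomorph.symm_apply_eq, hg _ (f.symm ⟨y, hy⟩).2]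
  simp

lemma image_eq_of_extends {g : X ≃ₜ X} (hg : ∀ (x : X) (hx : x ∈ Aᶜ), g x = ↑(f ⟨x, hx⟩)) :
    g '' A = B := by
  rw [← compl_inj_iff, ← image_compl_eq g.bijective]
  refine Subset.antisymm ?_ fun y hy => ⟨g.symm y, ?_, g.apply_symm_apply y⟩
  · rintro _ ⟨x, hx, rfl⟩
    rw [hg x hx]
    exact Subtype.coe_prop _
  · rw [symm_extends hg y hy]
    exact Subtype.coe_prop _

lemma uniformContinuous_of_extends [CompactSpace X] {g : X ≃ₜ X}
    (hg : ∀ (x : X) (hx : x ∈ Aᶜ), g x = ↑(f ⟨x, hx⟩)) : UniformContinuous f := by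
  refine uniformContinuous_comap' ?_
  have : (Subtype.val ∘ f : ↥(Aᶜ) → X) = g ∘ Subtype.val := funext fun x => (hg x x.2).symm
  rw [this]
  exact (CompactSpace.uniformContinuous_of_continuous g.continuous).comp
    uniformContinuous_subtype_val

lemma interior_subsingleton_of_unique [CompactSpace X] [TotallyDisconnectedSpace X]
    {g : X ≃ₜ X} (hg : ∀ (x : X) (hx : x ∈ Aᶜ), g x = ↑(f ⟨x, hx⟩))
    (huniq : ∀ g' : X ≃ₜ X, (∀ (x : X) (hx : x ∈ Aᶜ), g' x = ↑(f ⟨x, hx⟩)) → g' = g) :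
    (interior A).Subsingleton := by
  rw [← not_nontrivial_iff]
  intro hnt
  obtain ⟨σ, hσ, hσA⟩ := exists_homeomorph_ne_refl_of_isOpen isOpen_interior hnt
  have := huniq (σ.trans g) fun x hx => by
    rw [Homeomorph.trans_apply, hσA x fun h => hx (interior_subset h), hg x hx]
  exact hσ (Homeomorph.ext fun x => g.injective (DFunLike.congr_fun this x))

lemma extension_unique {g₁ g₂ : X ≃ₜ X} (hA : (interior A).Subsingleton)
    (h₁ : ∀ (x : X) (hx : x ∈ Aᶜ), g₁ x = ↑(f ⟨x, hx⟩))
    (h₂ : ∀ (x : X) (hx : x ∈ Aᶜ), g₂ x = ↑(f ⟨x, hx⟩)) : g₁ = g₂ := by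
  have heq : EqOn g₁ g₂ (closure Aᶜ) :=
    EqOn.closure (fun x hx => by rw [h₁ x hx, h₂ x hx]) g₁.continuous g₂.continuous
  rw [closure_compl] at heq
  ext x
  by_cases hx : x ∈ interior A
  · have hy : g₂ (g₂.symm (g₁ x)) = g₁ x := g₂.apply_symm_apply _
    by_cases hyA : g₂.symm (g₁ x) ∈ interior A
    · rwa [hA hyA hx, eq_comm] at hy
    · rw [← heq hyA] at hy
      exact absurd hx (g₁.injective hy ▸ hyA)
  · exact heq hx

lemma exists_extension [CompactSpace X] (hf : UniformContinuous f)
    (hf' : UniformContinuous f.symm) (hA : IsClosed (interior A)) (hB : IsClosed (interior B))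
    (k : interior A ≃ₜ interior B) :
    ∃ g : X ≃ₜ X, ∀ (x : X) (hx : x ∈ Aᶜ), g x = ↑(f ⟨x, hx⟩) := by
  obtain ⟨h, hh⟩ := exists_homeomorph_closure_extending f hf hf'
  have hclA : (closure Aᶜ)ᶜ = interior A := by rw [closure_compl, compl_compl]
  have hclB : (closure Bᶜ)ᶜ = interior B := by rw [closure_compl, compl_compl]
  have hPA : IsClopen (closure Aᶜ) := by
    rw [closure_compl]
    exact IsClopen.compl ⟨hA, isOpen_interior⟩
  have hPB : IsClopen (closure Bᶜ) := by
    rw [closure_compl]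
    exact IsClopen.compl ⟨hB, isOpen_interior⟩
  obtain ⟨g, hg, -⟩ := hPA.exists_homeomorph_extending hPB h
    (((Homeomorph.setCongr hclA).trans k).trans (Homeomorph.setCongr hclB.symm))
  exact ⟨g, fun x hx => (hg ⟨x, subset_closure hx⟩).trans (hh ⟨x, hx⟩)⟩

end Decisive

end Auxiliary

theorem stmt_16 {X : Type*} [MetricSpace X] [CompactSpace X] [Nonempty X]
    (hzero : ZeroDim X) (A B : Set X) (hA : IsClosed A) (hB : IsClosed B)
    (f : ↥(Aᶜ) ≃ₜ ↥(Bᶜ)) :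
    (∃! g : X ≃ₜ X, ∀ (x : X) (hx : x ∈ Aᶜ), g x = ↑(f ⟨x, hx⟩)) ↔
      (UniformContinuous (⇑f : ↥(Aᶜ) → ↥(Bᶜ)) ∧
       UniformContinuous (⇑f.symm : ↥(Bᶜ) → ↥(Aᶜ)) ∧
       ((interior A = ∅ ∧ interior B = ∅) ∨
        (∃ a b : X, IsOpen ({a} : Set X) ∧ IsOpen ({b} : Set X) ∧
          interior A = {a} ∧ interior B = {b}))) := by
  have : TotallySeparatedSpace X := by
    obtain ⟨S, hS, hbasis⟩ := hzero
    exact totallySeparatedSpace_of_t0_of_basis_clopen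
      (hbasis.of_isOpen_of_subset (fun s hs => hs.isOpen) hS)
  constructor
  · rintro ⟨g, hg, huniq⟩
    have himg : g '' interior A = interior B := by
      rw [g.image_interior, image_eq_of_extends hg]
    refine ⟨uniformContinuous_of_extends hg, uniformContinuous_of_extends (symm_extends hg), ?_⟩
    rcases (interior_subsingleton_of_unique hg huniq).eq_empty_or_singleton with h | ⟨a, h⟩
    · exact Or.inl ⟨h, by rw [← himg, h, Set.image_empty]⟩
    · have hB' : interior B = {g a} := by rw [← himg, h, Set.image_singleton]
      exact Or.inr ⟨a, g a, h ▸ isOpen_interior, hB' ▸ isOpen_interior, h, hB'⟩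
  · rintro ⟨hf, hf', ⟨hA', hB'⟩ | ⟨a, b, -, -, hA', hB'⟩⟩
    · obtain ⟨g, hg⟩ := exists_extension hf hf' (by simp [hA']) (by simp [hB'])
        ((Homeomorph.setCongr hA').trans (Homeomorph.setCongr hB'.symm))
      exact ⟨g, hg, fun g' hg' => extension_unique (by simp [hA']) hg' hg⟩
    · have k : ({a} : Set X) ≃ₜ ({b} : Set X) := Homeomorph.homeomorphOfUnique _ _
      obtain ⟨g, hg⟩ := exists_extension hf hf' (by simp [hA']) (by simp [hB'])
        ((Homeomorph.setCongr hA').trans (k.trans (Homeomorph.setCongr hB'.symm)))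
      exact ⟨g, hg, fun g' hg' => extension_unique (by simp [hA']) hg' hg⟩
end

section
/- For every integer ℓ ≥ 2 there exists a recognizable family W of nonempty finite words over an alphabet A of cardinality ℓ such that, writing c(n) for the number of words of length n belonging to W, one has lim_{n→∞} (1/n) log₂ c(n) = log₂ ℓ. Here recognizability means: for every x ∈ A^ℤ there is at most one set S ⊆ ℤ which is unbounded above and unbounded below and such that for every pair of consecutive elements m < n of S the word x_m x_{m+1} ⋯ x_{n-1} belongs to W (i.e., every bi-infinite concatenation of members of W decomposes in a unique way). -/
open Filter

/-- `S` is a cutset of `x` relative to the family of words `W`: it is unbounded above and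
below, and between any two consecutive cut positions one reads a word of `W`. -/
def IsCutset {A : Type*} (W : Set (List A)) (x : ℤ → A) (S : Set ℤ) : Prop :=
  (∀ N : ℤ, ∃ s ∈ S, N < s) ∧ (∀ N : ℤ, ∃ s ∈ S, s < N) ∧
  ∀ m ∈ S, ∀ n ∈ S, m < n → (∀ j : ℤ, m < j → j < n → j ∉ S) →
    (List.ofFn fun i : Fin (n - m).toNat => x (m + (i : ℤ))) ∈ W

/-- A family of finite words is recognizable if every bi-infinite sequence admits at most
one decomposition into consecutive words of the family. -/
def IsRecognizable {A : Type*} (W : Set (List A)) : Prop :=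
  ∀ (x : ℤ → A) (S S' : Set ℤ), IsCutset W x S → IsCutset W x S' → S = S'

/-- The block of `x` on `[m, n)` is marked at level `k`: it starts with `k` letters `z`, there are
no `k` consecutive letters `z` after these, and its longest suffix avoiding `z` has length `k`. -/
structure IsMarkedBlock {A : Type*} (z : A) (x : ℤ → A) (m n : ℤ) (k : ℕ) : Prop where
  pos : 1 ≤ k
  lt : m + k < n
  head : ∀ j, m ≤ j → j < m + k → x j = z
  sparse : ∀ s, m + k ≤ s → s + k ≤ n → ∃ j, s ≤ j ∧ j < s + k ∧ x j ≠ z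
  foot : ∀ j, n - k ≤ j → j < n → x j ≠ z
  sep : x (n - k - 1) = z

/-- The words which are marked at some level. -/
def markedWords {A : Type*} (z : A) : Set (List A) :=
  {w | ∃ (y : ℤ → A) (n k : ℕ), IsMarkedBlock z y 0 n k ∧ w = List.ofFn fun i : Fin n => y i}

section Recognizability

variable {A : Type*} {z : A} {x : ℤ → A} {S T : Set ℤ}

theorem IsMarkedBlock.of_shift {y : ℤ → A} {m n : ℤ} {k : ℕ}
    (h : IsMarkedBlock z y 0 (n - m) k)
    (hxy : ∀ j, 0 ≤ j → j < n - m → x (m + j) = y j) : IsMarkedBlock z x m n k := by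
  have key : ∀ j, m ≤ j → j < n → x j = y (j - m) := fun j h₁ h₂ => by
    rw [← hxy (j - m) (by lia) (by lia), add_sub_cancel]
  have hp := h.pos
  have hl := h.lt
  refine ⟨hp, by lia, fun j h₁ h₂ => ?_, fun s h₁ h₂ => ?_, fun j h₁ h₂ => ?_, ?_⟩
  · rw [key j h₁ (by lia)]
    exact h.head _ (by lia) (by lia)
  · obtain ⟨j, h₃, h₄, h₅⟩ := h.sparse (s - m) (by lia) (by lia)
    refine ⟨m + j, by lia, by lia, ?_⟩
    rwa [hxy j (by lia) (by lia)]
  · rw [key j (by lia) h₂]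
    exact h.foot _ (by lia) (by lia)
  · rw [key _ (by lia) (by lia), ← h.sep]
    congr 1
    ring

theorem isMarkedBlock_of_ofFn_mem_markedWords {m n : ℤ} (hmn : m < n)
    (h : (List.ofFn fun i : Fin (n - m).toNat => x (m + (i : ℤ))) ∈ markedWords z) :
    ∃ k, IsMarkedBlock z x m n k := by
  obtain ⟨y, N, k, hy, hw⟩ := h
  have hN : (n - m).toNat = N := by simpa using congrArg List.length hw
  subst hN
  refine ⟨k, IsMarkedBlock.of_shift (y := y) (by rwa [Int.toNat_of_nonneg (by lia)] at hy) ?_⟩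
  intro j h₁ h₂
  have := congrFun (List.ofFn_injective hw) ⟨j.toNat, by lia⟩
  simpa [Int.toNat_of_nonneg h₁] using this

theorem IsCutset.exists_block (hS : IsCutset (markedWords z) x S) (p : ℤ) :
    ∃ m ∈ S, ∃ n ∈ S, m ≤ p ∧ p < n ∧ (∀ j ∈ S, j ≤ m ∨ n ≤ j) ∧
      ∃ k, IsMarkedBlock z x m n k := by
  obtain ⟨hup, hdown, hword⟩ := hS
  obtain ⟨m, ⟨hmS, hmp⟩, hm⟩ := Int.exists_greatest_of_bdd (P := fun j => j ∈ S ∧ j ≤ p)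
    ⟨p, fun j hj => hj.2⟩ (by obtain ⟨s, hs, h⟩ := hdown p; exact ⟨s, hs, h.le⟩)
  obtain ⟨n, ⟨hnS, hpn⟩, hn⟩ := Int.exists_least_of_bdd (P := fun j => j ∈ S ∧ p < j)
    ⟨p, fun j hj => hj.2.le⟩ (hup p)
  have hgap : ∀ j ∈ S, j ≤ m ∨ n ≤ j := fun j hj =>
    (le_or_gt j p).imp (fun h => hm j ⟨hj, h⟩) (fun h => hn j ⟨hj, h⟩)
  refine ⟨m, hmS, n, hnS, hmp, hpn, hgap, isMarkedBlock_of_ofFn_mem_markedWords (by lia) ?_⟩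
  refine hword m hmS n hnS (by lia) fun j h₁ h₂ hj => ?_
  have := hgap j hj
  lia

theorem IsCutset.apply_sub_one_ne (hS : IsCutset (markedWords z) x S) {a : ℤ} (ha : a ∈ S) :
    x (a - 1) ≠ z := by
  obtain ⟨m, -, n, -, hm, hn, hgap, k, hk⟩ := hS.exists_block (a - 1)
  have := hgap a ha
  have := hk.pos
  exact hk.foot _ (by lia) (by lia)

/-- A block starting strictly inside another block, right after a letter other than `z`, has a
smaller level. -/
theorem IsMarkedBlock.level_lt {m n a b : ℤ} {k l : ℕ} (h : IsMarkedBlock z x m n k)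
    (h' : IsMarkedBlock z x a b l) (hma : m < a) (han : a < n) (hx : x (a - 1) ≠ z) : l < k := by
  by_contra! hkl
  have h₁ : m + k ≤ a := by
    by_contra! hc
    exact hx (h.head _ (by lia) (by lia))
  rcases le_or_gt (a + k) n with h₂ | h₂
  · obtain ⟨j, h₃, h₄, h₅⟩ := h.sparse a h₁ h₂
    exact h₅ (h'.head j h₃ (by lia))
  · have := h.pos
    exact h.foot (n - 1) (by lia) (by lia) (h'.head _ (by lia) (by lia))

theorem IsMarkedBlock.not_mem_of_lt {k : ℕ} : ∀ {S T : Set ℤ},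
    IsCutset (markedWords z) x S → IsCutset (markedWords z) x T →
    ∀ {m n : ℤ}, n ∈ T → IsMarkedBlock z x m n k → ∀ a ∈ S, m < a → ¬ a < n := by
  induction k using Nat.strong_induction_on with
  | _ k ih =>
    intro S T hS hT m n hn hk a₀ ha₀ hma₀ ha₀n
    obtain ⟨a, ha, b, hb, han, hnb, hgap, l, hl⟩ := hS.exists_block (n - 1)
    have hma : m < a := by
      have := hgap a₀ ha₀
      lia
    have hlk := hk.level_lt hl hma (by lia) (hS.apply_sub_one_ne ha)
    rcases (show n ≤ b by lia).eq_or_lt with rfl | hnb'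
    · exact hk.foot _ (by lia) (by lia) hl.sep
    · exact ih l hlk hT hS hb hl n hn (by lia) hnb'

theorem IsCutset.subset_of_markedWords (hS : IsCutset (markedWords z) x S)
    (hT : IsCutset (markedWords z) x T) : S ⊆ T := by
  intro a ha
  obtain ⟨m, hm, n, hn, hma, han, -, k, hk⟩ := hT.exists_block a
  rcases hma.eq_or_lt with rfl | hma
  · exact hm
  · exact absurd han (hk.not_mem_of_lt hS hT hn a ha hma)

theorem isRecognizable_markedWords (z : A) : IsRecognizable (markedWords z) :=
  fun _ _ _ hS hT => (hS.subset_of_markedWords hT).antisymm (hT.subset_of_markedWords hS)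

theorem ne_nil_of_mem_markedWords {w : List A} (hw : w ∈ markedWords z) : w ≠ [] := by
  obtain ⟨y, n, k, h, rfl⟩ := hw
  have := h.lt
  simp only [ne_eq, List.ofFn_eq_nil_iff]
  lia

end Recognizability

section Counting

variable {A : Type*}

/-- The positions of a word of length `n` which `markedFill` overwrites. -/
def IsFixedPos (n k i : ℕ) : Prop := i < k ∨ n ≤ i + 2 * k ∨ k ∣ i

instance (n k : ℕ) : DecidablePred (IsFixedPos n k) :=
  fun _ => inferInstanceAs (Decidable (_ ∨ _ ∨ _))

/-- The sequence with values `u` at the free positions, completed into a block marked at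
level `k`. -/
noncomputable def markedFill (z o : A) (n k : ℕ) (u : {i : Fin n // ¬ IsFixedPos n k i} → A) (j : ℤ) : A :=
  if j < k then z else if j = n - k - 1 then z else
    if h : ∃ i : {i : Fin n // ¬ IsFixedPos n k i}, ((i : Fin n) : ℤ) = j then u h.choose else o

variable {z o : A} {n k : ℕ} (u : {i : Fin n // ¬ IsFixedPos n k i} → A)

theorem markedFill_free (hk : 0 < k) (i : {i : Fin n // ¬ IsFixedPos n k i}) :
    markedFill z o n k u ((i : Fin n) : ℤ) = u i := by
  have hi := i.2
  simp only [IsFixedPos, not_or] at hi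
  have h : ∃ i' : {i : Fin n // ¬ IsFixedPos n k i}, ((i' : Fin n) : ℤ) = ((i : Fin n) : ℤ) :=
    ⟨i, rfl⟩
  rw [markedFill, if_neg (by lia), if_neg (by lia), dif_pos h]
  congr 1
  have := h.choose_spec
  exact Subtype.ext (Fin.ext (by exact_mod_cast this))

theorem markedFill_fixed {i : ℕ} (hi : IsFixedPos n k i) (hk : k ≤ i) (hne : (i : ℤ) ≠ n - k - 1) :
    markedFill z o n k u i = o := by
  rw [markedFill, if_neg (by lia), if_neg hne, dif_neg]
  rintro ⟨j, hj⟩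
  have : ((j : Fin n) : ℕ) = i := by exact_mod_cast hj
  exact j.2 (this ▸ hi)

theorem isMarkedBlock_markedFill (hzo : z ≠ o) (hk : 2 ≤ k) (hkn : 3 * k ≤ n) :
    IsMarkedBlock z (markedFill z o n k u) 0 n k := by
  refine ⟨by lia, by lia, fun j h₁ h₂ => ?_, fun s h₁ h₂ => ?_, fun j h₁ h₂ => ?_, ?_⟩
  · rw [markedFill, if_pos (by lia)]
  · lift s to ℕ using by lia
    rcases lt_or_ge (s + 2 * k) n with hs | hs
    · have hmod := Nat.mod_lt (s + k - 1) (show 0 < k by lia)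
      have hle := Nat.mod_le (s + k - 1) k
      refine ⟨((s + k - 1 - (s + k - 1) % k : ℕ) : ℤ), by lia, by lia, ?_⟩
      rw [markedFill_fixed u (.inr (.inr (Nat.dvd_sub_mod _))) (by lia) (by lia)]
      exact hzo.symm
    · by_cases hc : (s : ℤ) = n - k - 1
      · refine ⟨((s + 1 : ℕ) : ℤ), by lia, by lia, ?_⟩
        rw [markedFill_fixed u (.inr (.inl (by lia))) (by lia) (by lia)]
        exact hzo.symm
      · refine ⟨s, by lia, by lia, ?_⟩
        rw [markedFill_fixed u (.inr (.inl (by lia))) (by lia) hc]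
        exact hzo.symm
  · lift j to ℕ using by lia
    rw [markedFill_fixed u (.inr (.inl (by lia))) (by lia) (by lia)]
    exact hzo.symm
  · rw [markedFill, if_neg (by lia), if_pos rfl]

theorem finite_setOf_mem_and_length_eq [Finite A] (W : Set (List A)) (n : ℕ) :
    {w : List A | w ∈ W ∧ w.length = n}.Finite :=
  (List.finite_length_eq A n).subset fun _ h => h.2

theorem card_setOf_mem_and_length_eq_le [Fintype A] (W : Set (List A)) (n : ℕ) :
    Nat.card {w : List A | w ∈ W ∧ w.length = n} ≤ Fintype.card A ^ n := by
  rw [← card_vector n, ← Nat.card_eq_fintype_card]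
  exact Nat.card_mono (List.finite_length_eq A n) fun _ h => h.2

theorem pow_card_free_le [Fintype A] (hzo : z ≠ o) (hk : 2 ≤ k) (hkn : 3 * k ≤ n) :
    Fintype.card A ^ Fintype.card {i : Fin n // ¬ IsFixedPos n k i} ≤
      Nat.card {w : List A | w ∈ markedWords z ∧ w.length = n} := by
  classical
  have : Finite {w : List A | w ∈ markedWords z ∧ w.length = n} :=
    finite_setOf_mem_and_length_eq _ n
  rw [← Fintype.card_fun, ← Nat.card_eq_fintype_card]
  refine Nat.card_le_card_of_injective
    (fun u => ⟨List.ofFn fun i : Fin n => markedFill z o n k u i,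
      ⟨_, n, k, isMarkedBlock_markedFill u hzo hk hkn, rfl⟩, by simp⟩) fun u v huv => ?_
  funext i
  have h := congrFun (List.ofFn_injective (congrArg Subtype.val huv)) (i : Fin n)
  simpa only [markedFill_free _ (show 0 < k by lia)] using h

theorem le_card_free (hk : 0 < k) (n : ℕ) :
    n ≤ Fintype.card {i : Fin n // ¬ IsFixedPos n k i} + (3 * k + n / k + 1) := by
  have hsub : (Finset.univ.filter fun i : Fin n => IsFixedPos n k i).map Fin.valEmbedding ⊆
      Finset.range k ∪ (Finset.Ico (n - 2 * k) n ∪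
        (Finset.range (n / k + 1)).image fun q => k * q) := by
    intro i hi
    simp only [Finset.mem_map, Finset.mem_filter, Finset.mem_univ, true_and,
      Fin.valEmbedding_apply] at hi
    obtain ⟨i, hfix, rfl⟩ := hi
    have := i.2
    simp only [Finset.mem_union, Finset.mem_range, Finset.mem_Ico, Finset.mem_image]
    rcases hfix with h | h | ⟨q, hq⟩
    · exact .inl h
    · exact .inr (.inl ⟨by lia, i.2⟩)
    · refine .inr (.inr ⟨q, Nat.lt_succ_of_le ((Nat.le_div_iff_mul_le hk).2 ?_), hq.symm⟩)
      rw [mul_comm, ← hq]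
      exact i.2.le
  have h₁ := Finset.card_le_card hsub
  have h₂ := Finset.card_union_le (Finset.range k) (Finset.Ico (n - 2 * k) n ∪
        (Finset.range (n / k + 1)).image fun q => k * q)
  have h₃ := Finset.card_union_le (Finset.Ico (n - 2 * k) n)
    ((Finset.range (n / k + 1)).image fun q => k * q)
  have h₄ := Finset.card_image_le (s := Finset.range (n / k + 1)) (f := fun q => k * q)
  have h₅ := Fintype.card_subtype_compl (fun i : Fin n => IsFixedPos n k i)
  have h₆ := Fintype.card_subtype (fun i : Fin n => IsFixedPos n k i)
  simp only [Finset.card_map, Finset.card_range, Nat.card_Ico, Fintype.card_fin] at *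
  lia

theorem pow_sub_sqrt_le [Fintype A] (hzo : z ≠ o) (hn : 9 ≤ n) :
    Fintype.card A ^ (n - (4 * n.sqrt + 3)) ≤
      Nat.card {w : List A | w ∈ markedWords z ∧ w.length = n} := by
  have h3 : 3 ≤ n.sqrt := Nat.le_sqrt.2 hn
  have hle : n.sqrt * n.sqrt ≤ n := Nat.sqrt_le n
  have hlt : n < (n.sqrt + 1) * (n.sqrt + 1) := Nat.lt_succ_sqrt n
  have hdiv : n / n.sqrt < n.sqrt + 3 := (Nat.div_lt_iff_lt_mul (by lia)).2 (by nlinarith)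
  have hfree := le_card_free (k := n.sqrt) (by lia) n
  have : Nonempty A := ⟨z⟩
  refine le_trans (Nat.pow_le_pow_right Fintype.card_pos ?_)
    (pow_card_free_le (k := n.sqrt) hzo (by lia) (by nlinarith))
  lia

theorem tendsto_logb_card_markedWords [Fintype A] (hzo : z ≠ o) :
    Tendsto (fun n : ℕ =>
      Real.logb 2 (Nat.card {w : List A | w ∈ markedWords z ∧ w.length = n}) / (n : ℝ))
      atTop (nhds (Real.logb 2 (Fintype.card A))) := by
  have : Nonempty A := ⟨z⟩
  have hcard : (0 : ℝ) < Fintype.card A := by exact_mod_cast Fintype.card_pos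
  have hlog : 0 ≤ Real.logb 2 (Fintype.card A) :=
    Real.logb_nonneg one_lt_two (by exact_mod_cast Fintype.card_pos)
  have hlow : Tendsto (fun n : ℕ => (1 - (4 * (√(n : ℝ))⁻¹ + 3 * (n : ℝ)⁻¹)) *
      Real.logb 2 (Fintype.card A)) atTop (nhds (Real.logb 2 (Fintype.card A))) := by
    have h₁ : Tendsto (fun n : ℕ => (n : ℝ)⁻¹) atTop (nhds 0) := tendsto_inv_atTop_nhds_zero_nat
    have h₂ : Tendsto (fun n : ℕ => (√(n : ℝ))⁻¹) atTop (nhds 0) :=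
      (Real.tendsto_sqrt_atTop.comp tendsto_natCast_atTop_atTop).inv_tendsto_atTop
    simpa using ((((h₂.const_mul 4).add (h₁.const_mul 3)).const_sub 1).mul_const
      (Real.logb 2 (Fintype.card A)))
  refine tendsto_of_tendsto_of_tendsto_of_le_of_le' hlow tendsto_const_nhds ?_ ?_
  all_goals
    filter_upwards [eventually_ge_atTop 9] with n hn
    have hn0 : (0 : ℝ) < n := by exact_mod_cast (by lia : 0 < n)
    have hpow := pow_sub_sqrt_le (A := A) hzo hn
    have hpos := (pow_pos (Fintype.card_pos (α := A)) (n - (4 * n.sqrt + 3))).trans_le hpow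
  · rw [le_div_iff₀ hn0]
    calc _ = ((n : ℝ) - (4 * √(n : ℝ) + 3)) * Real.logb 2 (Fintype.card A) := by
          have hs : (√(n : ℝ))⁻¹ * n = √(n : ℝ) := by
            rw [inv_mul_eq_div, Real.div_sqrt]
          have hi : (n : ℝ)⁻¹ * n = 1 := inv_mul_cancel₀ hn0.ne'
          linear_combination (-4 * Real.logb 2 (Fintype.card A)) * hs
            - 3 * Real.logb 2 (Fintype.card A) * hi
      _ ≤ ((n - (4 * n.sqrt + 3) : ℕ) : ℝ) * Real.logb 2 (Fintype.card A) := by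
          refine mul_le_mul_of_nonneg_right ?_ hlog
          have h₁ : (n : ℝ) ≤ ((n - (4 * n.sqrt + 3) : ℕ) : ℝ) + (4 * n.sqrt + 3) := by
            exact_mod_cast (by lia : n ≤ (n - (4 * n.sqrt + 3)) + (4 * n.sqrt + 3))
          have h₂ := Real.nat_sqrt_le_real_sqrt (a := n)
          linarith
      _ = Real.logb 2 ((Fintype.card A : ℝ) ^ (n - (4 * n.sqrt + 3))) := by
          rw [Real.logb_pow]
      _ ≤ _ := Real.logb_le_logb_of_le one_lt_two (by positivity) (by exact_mod_cast hpow)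
  · rw [div_le_iff₀ hn0, mul_comm, ← Real.logb_pow]
    exact Real.logb_le_logb_of_le one_lt_two (by exact_mod_cast hpos)
      (by exact_mod_cast card_setOf_mem_and_length_eq_le _ n)

end Counting

theorem stmt_17 (ℓ : ℕ) (hℓ : 2 ≤ ℓ) :
    ∃ W : Set (List (Fin ℓ)),
      (∀ w ∈ W, w ≠ []) ∧ IsRecognizable W ∧
      Tendsto
        (fun n : ℕ =>
          Real.logb 2 (Nat.card {w : List (Fin ℓ) | w ∈ W ∧ w.length = n}) / (n : ℝ))
        atTop (nhds (Real.logb 2 ℓ)) := by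
  have hzo : (⟨0, by lia⟩ : Fin ℓ) ≠ ⟨1, by lia⟩ := by simp
  refine ⟨markedWords ⟨0, by lia⟩, fun w hw => ne_nil_of_mem_markedWords hw,
    isRecognizable_markedWords _, ?_⟩
  simpa only [Fintype.card_fin] using tendsto_logb_card_markedWords hzo
end
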